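/- For every integer n ≥ 1, the polynomial identity P_n(x) = Σ_{T ∈ T_n^e} 2^{fr(T) − 1 − max(T)} · x^{max(T)} holds (in particular fr(T) − 1 − max(T) ≥ 0 for every T ∈ T_n^e, so every summand is a polynomial with nonnegative integer coefficients). -/

import Mathlib

open scoped Classical

namespace SymDellac

/-- The polynomials `P n` (for `n ≥ 1`) defined by `P 1 = 1` and
`P (n+1) (x) = ((x+2)(x+1)/2) P n (x+2) - (x(x-1)/2) P n (x)`. -/
noncomputable def P : ℕ → Polynomial ℚ
  | 0 => 1
  | 1 => 1
  | n + 2 =>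
      Polynomial.C (1/2 : ℚ) *
        ((Polynomial.X + 2) * (Polynomial.X + 1) * ((P (n+1)).comp (Polynomial.X + 2))
          - Polynomial.X * (Polynomial.X - 1) * (P (n+1)))

/-- The polynomials `D n` defined by `D 0 = 1` and
`D (n+1) (x) = (x+1)(x+2) D n (x+2) - x(x+1) D n (x)`. -/
noncomputable def D : ℕ → Polynomial ℚ
  | 0 => 1
  | n + 1 =>
      (Polynomial.X + 1) * (Polynomial.X + 2) * ((D n).comp (Polynomial.X + 2))
        - Polynomial.X * (Polynomial.X + 1) * (D n)

/-! ### Even extended Dellac configurations -/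

/-- `T` is an even extended Dellac configuration of size `n`. -/
def IsTne (n : ℕ) (T : Finset (ℕ × ℕ)) : Prop :=
  (∀ p ∈ T, 1 ≤ p.1 ∧ p.1 ≤ n ∧ 1 ≤ p.2 ∧ p.2 ≤ 2*n ∧ p.1 ≤ p.2) ∧
  (∀ i ∈ Finset.Icc 1 (2*n), (T.filter (fun p => p.2 = i)).card = 1) ∧
  (∀ j ∈ Finset.Icc 1 n, (T.filter (fun p => p.1 = j)).card = 2)

/-- The finite set of even extended Dellac configurations of size `n`. -/
noncomputable def TneF (n : ℕ) : Finset (Finset (ℕ × ℕ)) :=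
  ((Finset.Icc 1 n ×ˢ Finset.Icc 1 (2*n)).powerset).filter (IsTne n)

/-- Number of free points of an even extended Dellac configuration. -/
def frE (n : ℕ) (T : Finset (ℕ × ℕ)) : ℕ :=
  (T.filter (fun p => 2*n + 1 ≤ p.2 + p.1)).card

/-- The (unique) point of `T` in row `r` (junk value if there is none). -/
noncomputable def rowPt (T : Finset (ℕ × ℕ)) (r : ℕ) : ℕ × ℕ :=
  if h : ∃ p ∈ T, p.2 = r then h.choose else (0, 0)

/-- `p` is the upper of the two points of its column in `T`. -/
def IsUpper (T : Finset (ℕ × ℕ)) (p : ℕ × ℕ) : Prop :=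
  ∃ q ∈ T, q.1 = p.1 ∧ q.2 < p.2

/-- One step of the path of Definition 1.2 (even case). -/
noncomputable def stepE (n : ℕ) (T : Finset (ℕ × ℕ)) (p : ℕ × ℕ) : ℕ × ℕ :=
  if p.1 = n then p
  else if IsUpper T p then rowPt T (2*n - p.1) else rowPt T p.1

/-- The path `(p_0, p_1, …)` starting at the point of row `i` (even case). -/
noncomputable def pathE (n : ℕ) (T : Finset (ℕ × ℕ)) (i k : ℕ) : ℕ × ℕ :=
  (stepE n T)^[k] (rowPt T i)

/-- The set of points of the subsequence `S_T(i)` of strict column records. -/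
noncomputable def recSetE (n : ℕ) (T : Finset (ℕ × ℕ)) (i : ℕ) : Set (ℕ × ℕ) :=
  {p | ∃ k, pathE n T i k = p ∧ ∀ k' < k, (pathE n T i k').1 < p.1}

/-- `b(T)`: `B(T) = S_T(n)` has `b(T) + 1` elements. -/
noncomputable def bStat (n : ℕ) (T : Finset (ℕ × ℕ)) : ℕ := (recSetE n T n).ncard - 1

/-- `r(T)`: `R(T) = S_T(2n)` has `r(T) + 1` elements. -/
noncomputable def rStat (n : ℕ) (T : Finset (ℕ × ℕ)) : ℕ := (recSetE n T (2*n)).ncard - 1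

/-- Row of the upper point of column `c` of `T`. -/
noncomputable def upRow (T : Finset (ℕ × ℕ)) (c : ℕ) : ℕ := sSup {i | (c, i) ∈ T}

/-- Row of the lower point of column `c` of `T`. -/
noncomputable def lowRow (T : Finset (ℕ × ℕ)) (c : ℕ) : ℕ := sInf {i | (c, i) ∈ T}

/-- One step of the root sequence `I_T(j,i)`, in a tableau with `R` rows. -/
noncomputable def rStep (R j : ℕ) (T : Finset (ℕ × ℕ)) (x : ℕ) : ℕ :=
  if (j ≤ x ∧ x ≤ R - j) ∨ x = R then x
  else if R - j + 1 ≤ x ∧ x ≤ R - 1 then upRow T (R - x)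
  else lowRow T x

/-- `root_T(j,i)`: the eventual constant value of the sequence `I_T(j,i)`
(junk value `0` if the sequence is not eventually constant). -/
noncomputable def rootVal (R j : ℕ) (T : Finset (ℕ × ℕ)) (i : ℕ) : ℕ :=
  if h : ∃ v, ∃ N, ∀ k ≥ N, (rStep R j T)^[k] i = v then h.choose else 0

/-- The set `G(T)` for an even extended Dellac configuration. -/
noncomputable def GsetE (n : ℕ) (T : Finset (ℕ × ℕ)) : Set (ℕ × ℕ) :=
  {p | p ∈ T ∧ 2*n + 1 ≤ p.2 + p.1 ∧
    (∃ q ∈ T, q.1 = p.1 ∧ q ≠ p ∧ q ∈ recSetE n T n) ∧ rootVal (2*n) p.1 T p.2 = p.1}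

/-- `g(T) = |G(T)|`. -/
noncomputable def gStat (n : ℕ) (T : Finset (ℕ × ℕ)) : ℕ := (GsetE n T).ncard

/-- `max(T) = b(T) + r(T) + g(T)`. -/
noncomputable def maxStat (n : ℕ) (T : Finset (ℕ × ℕ)) : ℕ :=
  bStat n T + rStat n T + gStat n T

/-! ### Odd extended Dellac configurations -/

/-- `T` is an odd extended Dellac configuration of size `n`. -/
def IsTno (n : ℕ) (T : Finset (ℕ × ℕ)) : Prop :=
  (∀ p ∈ T, 1 ≤ p.1 ∧ p.1 ≤ n ∧ 1 ≤ p.2 ∧ p.2 ≤ 2*n+1 ∧ p.1 ≤ p.2) ∧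
  (∀ i : ℕ, (T.filter (fun p => p.2 = i)).card ≤ 1) ∧
  (∀ i ∈ Finset.Icc 1 n, (T.filter (fun p => p.2 = i)).card = 1) ∧
  (∀ j ∈ Finset.Icc 1 n, (T.filter (fun p => p.1 = j)).card = 2)

/-- The finite set of odd extended Dellac configurations of size `n`. -/
noncomputable def TnoF (n : ℕ) : Finset (Finset (ℕ × ℕ)) :=
  ((Finset.Icc 1 n ×ˢ Finset.Icc 1 (2*n+1)).powerset).filter (IsTno n)

/-- Number of free points of an odd extended Dellac configuration. -/
def frO (n : ℕ) (T : Finset (ℕ × ℕ)) : ℕ :=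
  (T.filter (fun p => 2*n + 2 ≤ p.2 + p.1)).card

/-- One step of the path (odd case): if the required row is empty, stay put. -/
noncomputable def stepO (n : ℕ) (T : Finset (ℕ × ℕ)) (p : ℕ × ℕ) : ℕ × ℕ :=
  if p.1 = n then p
  else
    let r : ℕ := if IsUpper T p then 2*n + 1 - p.1 else p.1
    if ∃ q ∈ T, q.2 = r then rowPt T r else p

/-- The path `(p_0, p_1, …)` starting at the point of row `i` (odd case). -/
noncomputable def pathO (n : ℕ) (T : Finset (ℕ × ℕ)) (i k : ℕ) : ℕ × ℕ :=
  (stepO n T)^[k] (rowPt T i)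

/-- The set of points of `V(T) = S_T(2n+1)` (empty if row `2n+1` is empty). -/
noncomputable def Vset (n : ℕ) (T : Finset (ℕ × ℕ)) : Set (ℕ × ℕ) :=
  if ∃ p ∈ T, p.2 = 2*n + 1 then
    {p | ∃ k, pathO n T (2*n+1) k = p ∧ ∀ k' < k, (pathO n T (2*n+1) k').1 < p.1}
  else ∅

/-- `v(T)`: the number of elements of `V(T)`. -/
noncomputable def vStat (n : ℕ) (T : Finset (ℕ × ℕ)) : ℕ := (Vset n T).ncard

/-- The set `G(T)` for an odd extended Dellac configuration. -/
noncomputable def GsetO (n : ℕ) (T : Finset (ℕ × ℕ)) : Set (ℕ × ℕ) :=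
  {p | p ∈ T ∧ 2*n + 2 ≤ p.2 + p.1 ∧
    (∃ q ∈ T, q.1 = p.1 ∧ q ≠ p ∧ q ∈ Vset n T) ∧ rootVal (2*n+1) p.1 T p.2 = p.1}

/-- `g(T) = |G(T)|` (odd case). -/
noncomputable def gStatO (n : ℕ) (T : Finset (ℕ × ℕ)) : ℕ := (GsetO n T).ncard

/-! ### Dellac configurations and symmetric Dellac configurations -/

/-- `D` is a Dellac configuration of size `N`. -/
def IsDC (N : ℕ) (D : Finset (ℕ × ℕ)) : Prop :=
  (∀ p ∈ D, 1 ≤ p.1 ∧ p.1 ≤ N ∧ 1 ≤ p.2 ∧ p.2 ≤ 2*N ∧ p.1 ≤ p.2 ∧ p.2 ≤ N + p.1) ∧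
  (∀ i ∈ Finset.Icc 1 (2*N), (D.filter (fun p => p.2 = i)).card = 1) ∧
  (∀ j ∈ Finset.Icc 1 N, (D.filter (fun p => p.1 = j)).card = 2)

/-- `D` is a symmetric Dellac configuration of size `N`. -/
def IsSDC (N : ℕ) (D : Finset (ℕ × ℕ)) : Prop :=
  IsDC N D ∧ ∀ p ∈ D, (N + 1 - p.1, 2*N + 1 - p.2) ∈ D

/-- The finite set of symmetric Dellac configurations of size `N`. -/
noncomputable def SDCF (N : ℕ) : Finset (Finset (ℕ × ℕ)) :=
  ((Finset.Icc 1 N ×ˢ Finset.Icc 1 (2*N)).powerset).filter (IsSDC N)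

/-! ### Surjective pistols -/

/-- `p` encodes a surjective pistol of size `n`: position `k` stands for `k+1 ∈ {1,…,2n}`
and value `p k` stands for `(p k) + 1 ∈ {2,4,…,2n}`. -/
def IsSP (n : ℕ) (p : Fin (2*n) → Fin (2*n)) : Prop :=
  (∀ k, Even ((p k : ℕ) + 1) ∧ (k : ℕ) ≤ (p k : ℕ)) ∧
  (∀ m : Fin (2*n), Even ((m : ℕ) + 1) → ∃ k, p k = m)

/-- The finite set of surjective pistols of size `n`. -/
noncomputable def SPF (n : ℕ) : Finset (Fin (2*n) → Fin (2*n)) :=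
  Finset.univ.filter (IsSP n)

/-- `max(f)`: the number of `j ∈ {1,…,2n-2}` with `f(j) = 2n`. -/
noncomputable def maxP (n : ℕ) (p : Fin (2*n) → Fin (2*n)) : ℕ :=
  (Finset.univ.filter (fun k : Fin (2*n) => (k : ℕ) + 1 ≤ 2*n - 2 ∧ (p k : ℕ) + 1 = 2*n)).card

/-- `fd(f)`: the number of doubled fixed points of `f`. -/
noncomputable def fdP (n : ℕ) (p : Fin (2*n) → Fin (2*n)) : ℕ :=
  (Finset.univ.filter (fun k : Fin (2*n) =>
    (k : ℕ) + 1 ≤ 2*n - 2 ∧ (p k : ℕ) = (k : ℕ) ∧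
      ∃ k' : Fin (2*n), (k' : ℕ) < (k : ℕ) ∧ p k' = p k)).card

end SymDellac
/-! ### More constructions -/

namespace SymDellac

/-- `e_{n,k} = Σ_{T ∈ T_n^e, max(T) = k} 2^{fr(T) - 1 - k}`. -/
noncomputable def eStat (n k : ℕ) : ℕ :=
  ∑ T ∈ (TneF n).filter (fun T => maxStat n T = k), 2 ^ (frE n T - 1 - k)

/-- The configuration `T_{n,max}` with points `(j,j)` and `(j, 2n+1-j)` for `j ∈ [n]`. -/
def Tmax (n : ℕ) : Finset (ℕ × ℕ) :=
  (Finset.Icc 1 n).image (fun j => (j, j)) ∪ (Finset.Icc 1 n).image (fun j => (j, 2*n + 1 - j))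

/-- The index of the (unique) empty row of an odd extended Dellac configuration. -/
noncomputable def emptyRowIdx (n : ℕ) (T : Finset (ℕ × ℕ)) : ℕ :=
  sInf {i | 1 ≤ i ∧ i ≤ 2*n + 1 ∧ ∀ p ∈ T, p.2 ≠ i}

/-- The map `φ : T_n^o → T_n^e` deleting the empty row. -/
noncomputable def phi (n : ℕ) (T : Finset (ℕ × ℕ)) : Finset (ℕ × ℕ) :=
  T.image (fun p => if emptyRowIdx n T < p.2 then (p.1, p.2 - 1) else p)

/-- `Omax(T)`: the set of all points of `B(T)`, `R(T)` and `G(T)`. -/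
noncomputable def OmaxE (n : ℕ) (T : Finset (ℕ × ℕ)) : Set (ℕ × ℕ) :=
  recSetE n T n ∪ recSetE n T (2*n) ∪ GsetE n T

/-- Insertion of a point in the box `(j, r)` of a tableau `U` with `R` rows:
add the point `(j, i₀)` where `i₀` is the (unique) row with no point of `U`
in columns `1,…,j-1` whose root equals `r`. -/
noncomputable def insertPt (R j r : ℕ) (U : Finset (ℕ × ℕ)) : Finset (ℕ × ℕ) :=
  if h : ∃ i0, j ≤ i0 ∧ i0 ≤ R ∧ (∀ p ∈ U, p.2 = i0 → j ≤ p.1) ∧ rootVal R j U i0 = r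
  then insert (j, h.choose) U else U

/-- One step (column `j`) of the construction of `P(T)`. -/
noncomputable def Pstep (n : ℕ) (T : Finset (ℕ × ℕ)) (U : Finset (ℕ × ℕ)) (j : ℕ) :
    Finset (ℕ × ℕ) :=
  let U1 := if ∃ p ∈ T, p.1 = j ∧ p ∈ recSetE n T n ∪ recSetE n T (2*n)
    then insertPt (2*n - 1) j (2*n - 1) U else U
  if ∃ p ∈ T, p.1 = j ∧ p ∈ GsetE n T then insertPt (2*n - 1) j j U1 else U1

/-- The map `P : T_n^e → T_{n-1}^o`. -/
noncomputable def Pmap (n : ℕ) (T : Finset (ℕ × ℕ)) : Finset (ℕ × ℕ) :=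
  (List.range' 1 (n-1)).foldl (Pstep n T)
    ((T.filter (fun p => p ∉ OmaxE n T)).image
      (fun p => (p.1, if p.2 < n then p.2 else p.2 - 1)))

end SymDellac

namespace SymDellac

open Polynomial in
/-- Pick one ball, either one of the `z` interchangeable balls of weight `2`, or one of the
balls of `A`, of weight `1`. -/
noncomputable def pick (Φ : Finset ℕ → ℚ[X] → ℚ[X]) (A : Finset ℕ) (z : ℚ[X]) : ℚ[X] :=
  2 * z * Φ A (z - 1) + ∑ a ∈ A, Φ (A.erase a) z

open Polynomial in
/-- Closing time `c`: the ball `c` must have been picked and the ball `M - c`, if it is left,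
becomes an interchangeable ball. -/
noncomputable def closeStage (M c : ℕ) (Φ : Finset ℕ → ℚ[X] → ℚ[X]) (A : Finset ℕ) (z : ℚ[X]) :
    ℚ[X] :=
  if c ∈ A then 0 else if M - c ∈ A then Φ (A.erase (M - c)) (z + 1) else Φ A z

open Polynomial in
/-- Weighted number of ways of picking two balls at each of the `k` times `c, c + 1, …`. -/
noncomputable def stageSum (M : ℕ) : ℕ → ℕ → Finset ℕ → ℚ[X] → ℚ[X]
  | 0, _ => fun _ _ => 1
  | k + 1, c => fun A z => C (1 / 2 : ℚ) * pick (pick (closeStage M c (stageSum M k (c + 1)))) A z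

open Polynomial in
/-- The ball `l` behaves as half of the formal sum of one interchangeable ball and `ε` times
no ball. -/
def SplitsBall (ε : ℚ[X]) (l : ℕ) (Φ : Finset ℕ → ℚ[X] → ℚ[X]) : Prop :=
  ∀ A z, l ∉ A → 2 * Φ (insert l A) z = Φ A (z + 1) + ε * Φ A z

open Polynomial in
lemma SplitsBall.pick {ε : ℚ[X]} {l : ℕ} {Φ : Finset ℕ → ℚ[X] → ℚ[X]} (h : SplitsBall ε l Φ) :
    SplitsBall ε l (pick Φ) := by
  intro A z hl
  have h1 := h A (z - 1) hl
  have h2 : ∑ a ∈ A, Φ ((insert l A).erase a) z = ∑ a ∈ A, Φ (insert l (A.erase a)) z := by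
    refine Finset.sum_congr rfl fun a ha => ?_
    rw [Finset.erase_insert_of_ne]
    rintro rfl; exact hl ha
  have h3 : 2 * ∑ a ∈ A, Φ (insert l (A.erase a)) z
      = ∑ a ∈ A, Φ (A.erase a) (z + 1) + ε * ∑ a ∈ A, Φ (A.erase a) z := by
    rw [Finset.mul_sum, Finset.mul_sum, ← Finset.sum_add_distrib]
    exact Finset.sum_congr rfl fun a _ => h _ _ fun hh => hl (Finset.mem_of_mem_erase hh)
  simp only [SymDellac.pick]
  rw [Finset.sum_insert hl, Finset.erase_insert hl, h2]
  rw [sub_add_cancel] at h1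
  rw [add_sub_cancel_right]
  linear_combination 2 * z * h1 + h3

open Polynomial in
lemma SplitsBall.const_mul {ε : ℚ[X]} {l : ℕ} {Φ : Finset ℕ → ℚ[X] → ℚ[X]}
    (h : SplitsBall ε l Φ) (a : ℚ[X]) : SplitsBall ε l (fun A z => a * Φ A z) := by
  intro A z hl
  linear_combination a * h A z hl

open Polynomial in
lemma SplitsBall.closeStage {ε : ℚ[X]} {l M c : ℕ} {Φ : Finset ℕ → ℚ[X] → ℚ[X]}
    (h : SplitsBall ε l Φ) (h1 : l ≠ c) (h2 : l ≠ M - c) :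
    SplitsBall ε l (closeStage M c Φ) := by
  intro A z hl
  simp only [SymDellac.closeStage, Finset.mem_insert, h1.symm, h2.symm, false_or]
  split_ifs
  · simp
  · rw [Finset.erase_insert_of_ne h2, h _ _ fun hh => hl (Finset.mem_of_mem_erase hh)]
  · exact h A z hl

open Polynomial in
lemma splitsBall_stageSum_low {M : ℕ} (k c : ℕ) :
    2 * (c + k) < M → SplitsBall (-1) (c + k) (stageSum M (k + 1) c) := by
  induction k generalizing c with
  | zero =>
    intro hM
    refine (SplitsBall.pick (SplitsBall.pick ?_)).const_mul _
    intro A z hl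
    simp only [add_zero] at hl
    simp [closeStage, stageSum, hl]
  | succ k ih =>
    intro hM
    have := ih (c + 1) (by omega)
    rw [show c + 1 + k = c + (k + 1) by ring] at this
    exact (SplitsBall.pick (SplitsBall.pick (this.closeStage (by omega) (by omega)))).const_mul _

open Polynomial in
lemma splitsBall_stageSum_up {M : ℕ} (k c : ℕ) :
    2 * (c + k) < M → SplitsBall 1 (M - (c + k)) (stageSum M (k + 1) c) := by
  induction k generalizing c with
  | zero =>
    intro hM
    refine (SplitsBall.pick (SplitsBall.pick ?_)).const_mul _
    intro A z hl
    have : c ≠ M - c := by omega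
    simp only [add_zero] at hl
    simp only [closeStage, stageSum, add_zero, Finset.mem_insert, this, false_or]
    split_ifs <;> norm_num
  | succ k ih =>
    intro hM
    have := ih (c + 1) (by omega)
    rw [show c + 1 + k = c + (k + 1) by ring] at this
    exact (SplitsBall.pick (SplitsBall.pick (this.closeStage (by omega) (by omega)))).const_mul _

open Polynomial in
lemma pick_mul {I : Finset ℕ → Prop} (hI : ∀ A a, I A → I (A.erase a))
    {Φ Ψ : Finset ℕ → ℚ[X] → ℚ[X]} {g : ℚ[X] → ℚ[X]}
    (h : ∀ A z, I A → Φ A z = Ψ A z * g (z + A.card)) (A : Finset ℕ) (z : ℚ[X]) (hA : I A) :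
    pick Φ A z = pick Ψ A z * g (z + A.card - 1) := by
  simp only [pick]
  rw [add_mul, Finset.sum_mul, h A _ hA, sub_add_eq_add_sub, mul_assoc (2 * z)]
  congr 1
  refine Finset.sum_congr rfl fun a ha => ?_
  rw [h _ _ (hI _ _ hA)]
  congr 2
  have : (A.card : ℚ[X]) = ((A.erase a).card : ℚ[X]) + 1 := by
    exact_mod_cast (Finset.card_erase_add_one ha).symm
  rw [this]; ring

open Polynomial in
lemma stageSum_succ {M : ℕ} (k c : ℕ) (A : Finset ℕ) (z : ℚ[X]) :
    2 * (c + k) < M → (∀ a ∈ A, (c ≤ a ∧ a < c + k) ∨ (M < a + c + k ∧ a + c ≤ M)) →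
    stageSum M (k + 1) c A z = stageSum M k c A z *
      (2 * (z + A.card - 2 * k) * (z + A.card - 2 * k - 1)) := by
  induction k generalizing c A z with
  | zero =>
    intro hM hA
    have : A = ∅ := Finset.eq_empty_of_forall_notMem fun a ha => by
      rcases hA a ha with h | h <;> omega
    subst this
    have h2 : (C (1 / 2 : ℚ)) * 2 = 1 := by
      rw [show (2 : ℚ[X]) = C 2 by rfl, ← C_mul]; norm_num
    simp [stageSum, pick, closeStage]
    simp only [one_div] at h2
    linear_combination (2 * z * (z - 1)) * h2
  | succ k ih =>
    intro hM hA
    let I : Finset ℕ → Prop := fun A =>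
      ∀ a ∈ A, (c ≤ a ∧ a < c + (k + 1)) ∨ (M < a + c + (k + 1) ∧ a + c ≤ M)
    have hIe : ∀ A a, I A → I (A.erase a) := fun A a h b hb => h b (Finset.mem_of_mem_erase hb)
    have key : ∀ A z, I A → closeStage M c (stageSum M (k + 1) (c + 1)) A z
        = closeStage M c (stageSum M k (c + 1)) A z *
          (fun y : ℚ[X] => 2 * (y - 2 * k) * (y - 2 * k - 1)) (z + A.card) := by
      intro A z hA
      simp only [closeStage]
      split_ifs with h1 h2
      · simp
      · rw [ih (c + 1) _ _ (by omega)]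
        · have : (A.card : ℚ[X]) = ((A.erase (M - c)).card : ℚ[X]) + 1 := by
            exact_mod_cast (Finset.card_erase_add_one h2).symm
          rw [this]; ring
        · intro a ha
          have h4 := hA a (Finset.mem_of_mem_erase ha)
          have h5 := Finset.ne_of_mem_erase ha
          have h6 : a ≠ c := by rintro rfl; exact h1 (Finset.mem_of_mem_erase ha)
          omega
      · rw [ih (c + 1) _ _ (by omega)]
        intro a ha
        have h4 := hA a ha
        have h5 : a ≠ M - c := by rintro rfl; exact h2 ha
        have h6 : a ≠ c := by rintro rfl; exact h1 ha
        omega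
    have hA' : I A := hA
    clear_value I
    obtain ⟨g, hg⟩ : ∃ g : ℚ[X] → ℚ[X],
        g = fun y : ℚ[X] => 2 * (y - 2 * k) * (y - 2 * k - 1) := ⟨_, rfl⟩
    rw [← hg] at key
    have h1 := pick_mul hIe key
    change C (1 / 2) * pick (pick (closeStage M c (stageSum M (k + 1) (c + 1)))) A z =
      C (1 / 2) * pick (pick (closeStage M c (stageSum M k (c + 1)))) A z * _
    generalize closeStage M c (stageSum M (k + 1) (c + 1)) = Φ at h1 ⊢
    generalize closeStage M c (stageSum M k (c + 1)) = Ψ at h1 ⊢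
    have h2 := pick_mul (Φ := pick Φ) (Ψ := pick Ψ)
      (g := fun y => g (y - 1)) hIe h1 A z hA'
    rw [h2, hg]
    push_cast
    ring

open Polynomial in
lemma stageSum_eq_comp {M : ℕ} (N : ℕ) (z : ℚ[X]) : 2 * N < M →
    stageSum M N 1 (Finset.Icc 1 N ∪ Finset.Icc (M - N) (M - 1)) z = (P (N + 1)).comp z := by
  induction N generalizing z with
  | zero => intro _; simp [stageSum, P]
  | succ N ih =>
    intro hM
    set A := Finset.Icc 1 N ∪ Finset.Icc (M - N) (M - 1) with hA
    have hset : Finset.Icc 1 (N + 1) ∪ Finset.Icc (M - (N + 1)) (M - 1)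
        = insert (1 + N) (insert (M - (1 + N)) A) := by
      ext a; simp [hA]; omega
    have h1 : M - (1 + N) ∉ A := by simp [hA]; omega
    have h2 : 1 + N ∉ insert (M - (1 + N)) A := by simp [hA]; omega
    have hcard : A.card = 2 * N := by
      rw [hA, Finset.card_union_of_disjoint]
      · simp; omega
      · rw [Finset.disjoint_left]; intro a; simp; omega
    have e1 := splitsBall_stageSum_low (M := M) N 1 (by omega) _ z h2
    have e2 := splitsBall_stageSum_up (M := M) N 1 (by omega) _ z h1
    have e3 := splitsBall_stageSum_up (M := M) N 1 (by omega) _ (z + 1) h1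
    have hmem : ∀ a ∈ A, (1 ≤ a ∧ a < 1 + N) ∨ (M < a + 1 + N ∧ a + 1 ≤ M) := by
      intro a; simp [hA]; omega
    have e4 := stageSum_succ (M := M) N 1 A z (by omega) hmem
    have e5 := stageSum_succ (M := M) N 1 A (z + 1 + 1) (by omega) hmem
    rw [ih _ (by omega), hcard] at e4 e5
    rw [hset, P]
    have h2 : (C (1 / 2 : ℚ)) * 2 = 1 := by
      rw [show (2 : ℚ[X]) = C 2 by rfl, ← C_mul]; norm_num
    have e6 : ((P (N + 1)).comp (X + 2)).comp z = (P (N + 1)).comp (z + 1 + 1) := by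
      rw [comp_assoc]; simp; congr 1; ring
    have e7 : (2 : ℚ[X]).comp z = 2 := by simp
    simp only [mul_comp, sub_comp, add_comp, X_comp, one_comp, e6, C_comp, e7]
    push_cast at e4 e5
    have h4 : (2 * 2 : ℚ[X]) ≠ 0 := by norm_num
    apply mul_left_cancel₀ h4
    linear_combination 2 * e1 + e3 - e2 + e5 - e4 -
      2 * ((z + 2) * (z + 1) * (P (N + 1)).comp (z + 1 + 1) -
        z * (z - 1) * (P (N + 1)).comp z) * h2

lemma two_mul_sum_powersetCard_two {R : Type*} [CommRing R] (E : Finset ℕ) (g : Finset ℕ → R) :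
    2 * ∑ S ∈ Finset.powersetCard 2 E, g S = ∑ a ∈ E, ∑ b ∈ E.erase a, g {a, b} := by
  have h1 : ∑ a ∈ E, ∑ b ∈ E.erase a, g {a, b} = ∑ p ∈ E.offDiag, g {p.1, p.2} := by
    rw [Finset.sum_sigma']
    refine Finset.sum_bij' (fun p _ => (p.1, p.2)) (fun p _ => ⟨p.1, p.2⟩) ?_ ?_ ?_ ?_ ?_
    · rintro ⟨a, b⟩; simp; tauto
    · rintro ⟨a, b⟩; simp; tauto
    all_goals simp
  have h2 : ∀ p ∈ E.offDiag, ({p.1, p.2} : Finset ℕ) ∈ Finset.powersetCard 2 E := by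
    rintro ⟨a, b⟩ h
    simp only [Finset.mem_offDiag] at h
    rw [Finset.mem_powersetCard]
    refine ⟨?_, Finset.card_pair h.2.2⟩
    intro i; simp; rintro (rfl | rfl); exacts [h.1, h.2.1]
  rw [h1, ← Finset.sum_fiberwise_of_maps_to h2, Finset.mul_sum]
  refine Finset.sum_congr rfl fun S hS => ?_
  rw [Finset.mem_powersetCard] at hS
  obtain ⟨a, b, hab, rfl⟩ := Finset.card_eq_two.1 hS.2
  have ha : a ∈ E := hS.1 (by simp)
  have hb : b ∈ E := hS.1 (by simp)
  have : E.offDiag.filter (fun p => ({p.1, p.2} : Finset ℕ) = {a, b}) = {(a, b), (b, a)} := by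
    ext ⟨u, v⟩
    simp only [Finset.mem_filter, Finset.mem_offDiag, Finset.mem_insert, Finset.mem_singleton,
      Prod.mk.injEq]
    constructor
    · rintro ⟨⟨-, -, huv⟩, h⟩
      have hu : u ∈ ({a, b} : Finset ℕ) := h ▸ (by simp)
      have hv : v ∈ ({a, b} : Finset ℕ) := h ▸ (by simp)
      simp only [Finset.mem_insert, Finset.mem_singleton] at hu hv
      grind
    · rintro (⟨rfl, rfl⟩ | ⟨rfl, rfl⟩)
      · exact ⟨⟨ha, hb, hab⟩, rfl⟩
      · exact ⟨⟨hb, ha, hab.symm⟩, Finset.pair_comm _ _⟩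
  rw [this, Finset.sum_pair (by simp [hab]), Finset.pair_comm b a]
  ring

lemma two_mul_sum_pairs {R : Type*} [CommRing R] {E A : Finset ℕ} (hA : A ⊆ E) (wt : ℕ → R)
    (hwt : ∀ a ∈ A, wt a = 1) (φ : Finset ℕ → R) :
    2 * ∑ S ∈ Finset.powersetCard 2 E, (∏ s ∈ S, wt s) * φ (A \ S) =
      ∑ a ∈ A, ∑ b ∈ A.erase a, φ ((A.erase a).erase b) +
      2 * (∑ b ∈ E \ A, wt b) * ∑ a ∈ A, φ (A.erase a) +
      ((∑ b ∈ E \ A, wt b) ^ 2 - ∑ b ∈ E \ A, wt b ^ 2) * φ A := by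
  have hsplit : ∀ f : ℕ → R, ∑ a ∈ E, f a = ∑ a ∈ A, f a + ∑ a ∈ E \ A, f a := fun f => by
    rw [add_comm, Finset.sum_sdiff hA]
  have hdiff : ∀ a b, A \ {a, b} = (A.erase a).erase b := fun a b => by
    ext i; simp; tauto
  have hin : ∀ a ∈ E, ∑ b ∈ E.erase a, (∏ s ∈ ({a, b} : Finset ℕ), wt s) * φ (A \ {a, b}) =
      wt a * (∑ b ∈ E, wt b * φ ((A.erase a).erase b) - wt a * φ (A.erase a)) := by
    intro a ha
    rw [← Finset.sum_erase_add _ _ ha, Finset.erase_eq_of_notMem (Finset.notMem_erase a A),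
      add_sub_cancel_right, Finset.mul_sum]
    refine Finset.sum_congr rfl fun b hb => ?_
    rw [Finset.prod_pair (Finset.ne_of_mem_erase hb).symm, hdiff, mul_assoc]
  rw [two_mul_sum_powersetCard_two, Finset.sum_congr rfl hin, hsplit]
  have hA1 : ∀ a ∈ A, wt a * (∑ b ∈ E, wt b * φ ((A.erase a).erase b) - wt a * φ (A.erase a)) =
      ∑ b ∈ A.erase a, φ ((A.erase a).erase b) + (∑ b ∈ E \ A, wt b) * φ (A.erase a) := by
    intro a ha
    rw [hwt a ha, hsplit, ← Finset.sum_erase_add _ _ ha, hwt a ha,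
      Finset.erase_eq_of_notMem (Finset.notMem_erase a A), Finset.sum_mul]
    have h1 : ∑ b ∈ A.erase a, wt b * φ ((A.erase a).erase b) =
        ∑ b ∈ A.erase a, φ ((A.erase a).erase b) :=
      Finset.sum_congr rfl fun b hb => by rw [hwt b (Finset.mem_of_mem_erase hb), one_mul]
    have h2 : ∑ b ∈ E \ A, wt b * φ ((A.erase a).erase b) = ∑ b ∈ E \ A, wt b * φ (A.erase a) :=
      Finset.sum_congr rfl fun b hb => by
        rw [Finset.erase_eq_of_notMem (a := b)]
        exact fun h => (Finset.mem_sdiff.1 hb).2 (Finset.mem_of_mem_erase h)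
    rw [h1, h2]; ring
  have hB1 : ∀ a ∈ E \ A,
      wt a * (∑ b ∈ E, wt b * φ ((A.erase a).erase b) - wt a * φ (A.erase a)) =
      wt a * (∑ b ∈ A, φ (A.erase b) + (∑ b ∈ E \ A, wt b) * φ A) - wt a ^ 2 * φ A := by
    intro a ha
    rw [Finset.erase_eq_of_notMem (Finset.mem_sdiff.1 ha).2, hsplit, Finset.sum_mul]
    have h1 : ∑ b ∈ A, wt b * φ (A.erase b) = ∑ b ∈ A, φ (A.erase b) :=
      Finset.sum_congr rfl fun b hb => by rw [hwt b hb, one_mul]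
    have h2 : ∑ b ∈ E \ A, wt b * φ (A.erase b) = ∑ b ∈ E \ A, wt b * φ A :=
      Finset.sum_congr rfl fun b hb => by
        rw [Finset.erase_eq_of_notMem (Finset.mem_sdiff.1 hb).2]
    rw [h1, h2]; ring
  rw [Finset.sum_congr rfl hA1, Finset.sum_congr rfl hB1, Finset.sum_add_distrib,
    Finset.sum_sub_distrib, ← Finset.sum_mul, ← Finset.sum_mul, ← Finset.mul_sum]
  ring

/-- The weight of a ball: `1` in `A`, `x` for the two special balls, `2` otherwise. -/
noncomputable def ballWt (A : Finset ℕ) (e₁ e₂ : ℕ) (s : ℕ) : Polynomial ℚ :=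
  if s ∈ A then 1 else if s = e₁ ∨ s = e₂ then Polynomial.X else 2

open Polynomial in
lemma sum_ballWt_pow {E A : Finset ℕ} (hA : A ⊆ E) {e₁ e₂ : ℕ} (h₁ : e₁ ∈ E \ A)
    (h₂ : e₂ ∈ E \ A) (hne : e₁ ≠ e₂) (k : ℕ) :
    ∑ b ∈ E \ A, ballWt A e₁ e₂ b ^ k =
      2 * X ^ k + ((E.card : ℚ[X]) - (A.card : ℚ[X]) - 2) * 2 ^ k := by
  rw [← Finset.sum_erase_add _ _ h₁,
    ← Finset.sum_erase_add _ _ (Finset.mem_erase.2 ⟨hne.symm, h₂⟩)]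
  have hw : ∀ b ∈ ((E \ A).erase e₁).erase e₂, ballWt A e₁ e₂ b ^ k = 2 ^ k := by
    intro b hb
    simp only [Finset.mem_erase, Finset.mem_sdiff] at hb
    simp [ballWt, hb]
  have hc : ((((E \ A).erase e₁).erase e₂).card : ℚ[X]) = E.card - (A.card : ℚ[X]) - 2 := by
    have h3 := Finset.card_erase_add_one h₁
    have h4 := Finset.card_erase_add_one (Finset.mem_erase.2 ⟨hne.symm, h₂⟩)
    have h5 := Finset.card_sdiff_add_card_eq_card hA
    have : E.card = (((E \ A).erase e₁).erase e₂).card + A.card + 2 := by omega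
    rw [this]; push_cast; ring
  rw [Finset.sum_congr rfl hw, Finset.sum_const, nsmul_eq_mul, hc]
  simp only [Finset.mem_sdiff] at h₁ h₂
  simp [ballWt, h₁, h₂]
  ring

open Polynomial in
lemma two_mul_sum_ballWt {E A : Finset ℕ} (hA : A ⊆ E) {e₁ e₂ : ℕ} (h₁ : e₁ ∈ E \ A)
    (h₂ : e₂ ∈ E \ A) (hne : e₁ ≠ e₂) (Φ : Finset ℕ → ℚ[X] → ℚ[X]) :
    2 * ∑ S ∈ Finset.powersetCard 2 E, (∏ s ∈ S, ballWt A e₁ e₂ s) *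
        Φ (A \ S) (X + (E.card : ℚ[X]) - 4 - ((A \ S).card : ℚ[X])) =
      pick (pick Φ) A (X + (E.card : ℚ[X]) - 2 - (A.card : ℚ[X])) -
        2 * (X ^ 2 - 2 * X) * Φ A (X + (E.card : ℚ[X]) - 4 - (A.card : ℚ[X])) := by
  rw [two_mul_sum_pairs hA (ballWt A e₁ e₂) (fun a ha => by simp [ballWt, ha])
    (fun B => Φ B (X + (E.card : ℚ[X]) - 4 - (B.card : ℚ[X])))]
  have s1 := sum_ballWt_pow hA h₁ h₂ hne 1
  have s2 := sum_ballWt_pow hA h₁ h₂ hne 2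
  simp only [pow_one] at s1
  rw [s1, s2]
  have hc : ∀ B : Finset ℕ, ∀ a ∈ B, ((B.erase a).card : ℚ[X]) = (B.card : ℚ[X]) - 1 := by
    intro B a ha
    rw [← Finset.card_erase_add_one ha]; push_cast; ring
  have t1 : ∑ a ∈ A, Φ (A.erase a) (X + (E.card : ℚ[X]) - 4 - ((A.erase a).card : ℚ[X])) =
      ∑ a ∈ A, Φ (A.erase a) (X + (E.card : ℚ[X]) - 2 - (A.card : ℚ[X]) - 1) :=
    Finset.sum_congr rfl fun a ha => by rw [hc A a ha]; congr 1; ring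
  have t2 : ∑ a ∈ A, ∑ b ∈ A.erase a, Φ ((A.erase a).erase b)
        (X + (E.card : ℚ[X]) - 4 - (((A.erase a).erase b).card : ℚ[X])) =
      ∑ a ∈ A, ∑ b ∈ A.erase a, Φ ((A.erase a).erase b)
        (X + (E.card : ℚ[X]) - 2 - (A.card : ℚ[X])) :=
    Finset.sum_congr rfl fun a ha => Finset.sum_congr rfl fun b hb => by
      rw [hc _ b hb, hc A a ha]; congr 1; ring
  have t3 : Φ A (X + (E.card : ℚ[X]) - 4 - (A.card : ℚ[X])) =
      Φ A (X + (E.card : ℚ[X]) - 2 - (A.card : ℚ[X]) - 1 - 1) := by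
    congr 1; ring
  simp only [t1, t2, t3, pick, Finset.sum_add_distrib, ← Finset.mul_sum]
  ring

/-- Number of points of column `c`, with set of rows `S`, that are free or lie in row `n`. -/
def colFree (n c : ℕ) (S : Finset ℕ) : ℕ := (S.filter fun i => i = n ∨ 2 * n + 1 ≤ i + c).card

/-- Contribution of column `c`, with set of rows `S` and root function `ρ`, to `max`. -/
noncomputable def colMax (n c : ℕ) (ρ : ℕ → ℕ) (S : Finset ℕ) : ℕ :=
  (S.filter fun i => ρ i = n).card + (S.filter fun i => ρ i = 2 * n).card +
    (S.filter fun i => 2 * n + 1 ≤ i + c ∧ (∃ q ∈ S, q ≠ i ∧ ρ q = n) ∧ ρ i = c).card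

open Polynomial in
/-- Weight of column `c`. -/
noncomputable def colWt (n c : ℕ) (ρ : ℕ → ℕ) (S : Finset ℕ) : ℚ[X] :=
  C ((2 : ℚ) ^ (colFree n c S - colMax n c ρ S)) * X ^ colMax n c ρ S

/-- `ρ` behaves like the root function on the set `E` of rows that are empty before column `c`
is filled. -/
structure IsRootMap (n c : ℕ) (E : Finset ℕ) (ρ : ℕ → ℕ) : Prop where
  mem : ∀ i ∈ E, c ≤ i ∧ i ≤ 2 * n
  card : E.card + 2 * c = 2 * n + 2
  inj : Set.InjOn ρ E
  surj : ∀ l, (c ≤ l ∧ l ≤ 2 * n - c) ∨ l = 2 * n → ∃ i ∈ E, ρ i = l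
  fix : ∀ i ∈ E, i + c ≤ 2 * n → ρ i = i

/-- The rows of `E` other than `n` that are not free in column `c`. -/
def boundRows (n c : ℕ) (E : Finset ℕ) : Finset ℕ := E.filter fun i => i + c ≤ 2 * n ∧ i ≠ n

lemma boundRows_subset (n c : ℕ) (E : Finset ℕ) : boundRows n c E ⊆ E := Finset.filter_subset _ _

open Polynomial in
/-- Weighted number of ways of completing a configuration whose columns before `c` are filled,
if `E` is the set of empty rows and `k` columns of variable weight remain. -/
noncomputable def stateSum (n k c : ℕ) (E : Finset ℕ) : ℚ[X] :=
  stageSum (2 * n) k c (boundRows n c E)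
    (X + (E.card : ℚ[X]) - 2 - ((boundRows n c E).card : ℚ[X]))

lemma IsRootMap.notMem_boundRows {n c : ℕ} {E : Finset ℕ} {ρ : ℕ → ℕ} (h : IsRootMap n c E ρ)
    (hc : 1 ≤ c) {i : ℕ} (hi : i ∈ E) (hr : ρ i = n ∨ ρ i = 2 * n) : i ∉ boundRows n c E := by
  intro hh
  simp only [boundRows, Finset.mem_filter] at hh
  have := h.fix i hi hh.2.1
  omega

open Polynomial in
lemma prod_ballWt (A S : Finset ℕ) {e₁ e₂ : ℕ} (h₁ : e₁ ∉ A) (h₂ : e₂ ∉ A) :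
    (S.filter fun i => i = e₁ ∨ i = e₂).card ≤ (S.filter fun i => i ∉ A).card ∧
    ∏ s ∈ S, ballWt A e₁ e₂ s =
      C ((2 : ℚ) ^ ((S.filter fun i => i ∉ A).card - (S.filter fun i => i = e₁ ∨ i = e₂).card)) *
        X ^ (S.filter fun i => i = e₁ ∨ i = e₂).card := by
  have hsub : (S.filter fun i => i = e₁ ∨ i = e₂) ⊆ (S.filter fun i => i ∉ A) := by
    intro i; simp only [Finset.mem_filter]; rintro ⟨hi, rfl | rfl⟩ <;> exact ⟨hi, ‹_›⟩
  refine ⟨Finset.card_le_card hsub, ?_⟩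
  have h3 : ((S.filter fun i => i ∉ A).filter fun i => i = e₁ ∨ i = e₂) =
      (S.filter fun i => i = e₁ ∨ i = e₂) := by
    rw [Finset.filter_filter]
    refine Finset.filter_congr fun i _ => ⟨fun h => h.2, fun h => ⟨?_, h⟩⟩
    rcases h with rfl | rfl <;> assumption
  have h4 := Finset.card_filter_add_card_filter_not (s := S.filter fun i => i ∉ A)
    (fun i => i = e₁ ∨ i = e₂)
  rw [h3] at h4
  simp only [ballWt]
  rw [Finset.prod_ite, Finset.prod_const_one, one_mul, Finset.prod_ite, Finset.prod_const,
    Finset.prod_const, h3, ← h4, Nat.add_sub_cancel_left, mul_comm, C_pow]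
  rfl

open Polynomial in
lemma colWt_eq {n c : ℕ} {E : Finset ℕ} {ρ : ℕ → ℕ} (h : IsRootMap n c E ρ) (hc : 1 ≤ c)
    (hcn : c < n) {e₁ e₂ e₃ : ℕ} (m₁ : e₁ ∈ E) (m₂ : e₂ ∈ E) (m₃ : e₃ ∈ E) (h₁ : ρ e₁ = n)
    (h₂ : ρ e₂ = 2 * n) (h₃ : ρ e₃ = c) {S : Finset ℕ} (hS : S ∈ Finset.powersetCard 2 E) :
    colMax n c ρ S ≤ colFree n c S ∧
    colWt n c ρ S = ∏ s ∈ S, ballWt (boundRows n c E) e₁ e₂ s +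
      if e₃ ≠ c ∧ S = {e₁, e₃} then X ^ 2 - 2 * X else 0 := by
  rw [Finset.mem_powersetCard] at hS
  obtain ⟨hSE, hScard⟩ := hS
  have i₁ : ∀ i ∈ E, ρ i = n ↔ i = e₁ := fun i hi =>
    ⟨fun hh => h.inj hi m₁ (hh.trans h₁.symm), fun hh => hh ▸ h₁⟩
  have i₂ : ∀ i ∈ E, ρ i = 2 * n ↔ i = e₂ := fun i hi =>
    ⟨fun hh => h.inj hi m₂ (hh.trans h₂.symm), fun hh => hh ▸ h₂⟩
  have i₃ : ∀ i ∈ E, ρ i = c ↔ i = e₃ := fun i hi =>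
    ⟨fun hh => h.inj hi m₃ (hh.trans h₃.symm), fun hh => hh ▸ h₃⟩
  have n₁ := h.notMem_boundRows hc m₁ (Or.inl h₁)
  have n₂ := h.notMem_boundRows hc m₂ (Or.inr h₂)
  have d12 : e₁ ≠ e₂ := by rintro rfl; omega
  have d13 : e₁ ≠ e₃ := by rintro rfl; omega
  have d23 : e₂ ≠ e₃ := by rintro rfl; omega
  have free₃ : e₃ ≠ c ↔ 2 * n + 1 ≤ e₃ + c := by
    constructor
    · intro hne
      by_contra hlt
      exact hne ((h.fix e₃ m₃ (by omega)).symm.trans h₃)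
    · intro hle; omega
  have hfree : colFree n c S = (S.filter fun i => i ∉ boundRows n c E).card := by
    unfold colFree
    congr 1
    refine Finset.filter_congr fun i hi => ?_
    simp only [boundRows, Finset.mem_filter, hSE hi, true_and]
    omega
  have hmax : (S.filter fun i => ρ i = n).card + (S.filter fun i => ρ i = 2 * n).card =
      (S.filter fun i => i = e₁ ∨ i = e₂).card := by
    rw [Finset.filter_or, Finset.card_union_of_disjoint]
    · congr 2
      · exact Finset.filter_congr fun i hi => i₁ i (hSE hi)
      · exact Finset.filter_congr fun i hi => i₂ i (hSE hi)
    · rw [Finset.disjoint_filter]; rintro i - rfl; exact d12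
  obtain ⟨hle, hprod⟩ := prod_ballWt (boundRows n c E) S n₁ n₂
  by_cases hG : e₃ ≠ c ∧ S = {e₁, e₃}
  · have e1 : colFree n c S = 2 := by
      rw [hfree, hG.2, Finset.filter_true_of_mem, Finset.card_pair d13]
      have := free₃.1 hG.1
      intro i hi
      simp only [Finset.mem_insert, Finset.mem_singleton] at hi
      rcases hi with rfl | rfl
      · exact n₁
      · simp [boundRows]; omega
    have e2 : (S.filter fun i => i = e₁ ∨ i = e₂).card = 1 := by
      rw [hG.2, Finset.filter_insert, Finset.filter_singleton]
      simp [d13.symm, d23.symm]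
    have e3 : (S.filter fun i => 2 * n + 1 ≤ i + c ∧ (∃ q ∈ S, q ≠ i ∧ ρ q = n) ∧ ρ i = c).card
        = 1 := by
      rw [Finset.card_eq_one]
      refine ⟨e₃, ?_⟩
      ext i
      simp only [Finset.mem_filter, Finset.mem_singleton]
      constructor
      · rintro ⟨hi, -, -, h4⟩; exact (i₃ i (hSE hi)).1 h4
      · rintro rfl
        refine ⟨by simp [hG.2], free₃.1 hG.1, ⟨e₁, by simp [hG.2], d13, h₁⟩, h₃⟩
    have e4 : colMax n c ρ S = 2 := by rw [colMax, hmax, e2, e3]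
    refine ⟨by omega, ?_⟩
    rw [if_pos hG, hprod, colWt, e4, e1, ← hfree, e1, e2]
    norm_num
    rw [show (C (2 : ℚ)) = 2 from rfl]; ring
  · have e3 : (S.filter fun i => 2 * n + 1 ≤ i + c ∧ (∃ q ∈ S, q ≠ i ∧ ρ q = n) ∧ ρ i = c).card
        = 0 := by
      rw [Finset.card_eq_zero]
      refine Finset.filter_eq_empty_iff.2 ?_
      rintro i hi ⟨h4, ⟨q, hq, hqi, hqn⟩, h5⟩
      obtain rfl := (i₃ i (hSE hi)).1 h5
      obtain rfl := (i₁ q (hSE hq)).1 hqn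
      refine hG ⟨free₃.2 h4, (Finset.eq_of_subset_of_card_le ?_ ?_).symm⟩
      · intro j; simp only [Finset.mem_insert, Finset.mem_singleton]
        rintro (rfl | rfl) <;> assumption
      · rw [hScard, Finset.card_pair hqi]
    have e4 : colMax n c ρ S = (S.filter fun i => i = e₁ ∨ i = e₂).card := by
      rw [colMax, hmax, e3, add_zero]
    rw [if_neg hG, add_zero, hprod, colWt, e4, hfree]
    exact ⟨hle, rfl⟩

open Polynomial in
lemma stateSum_succ {n c : ℕ} (k : ℕ) {E : Finset ℕ} {ρ : ℕ → ℕ} (h : IsRootMap n c E ρ)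
    (hc : 1 ≤ c) (hcn : c < n) :
    ∑ S ∈ (Finset.powersetCard 2 E).filter (fun S => c ∈ E → c ∈ S),
      colWt n c ρ S * stateSum n k (c + 1) (E \ S) = stateSum n (k + 1) c E := by
  obtain ⟨e₁, m₁, h₁⟩ := h.surj n (by omega)
  obtain ⟨e₂, m₂, h₂⟩ := h.surj (2 * n) (by omega)
  obtain ⟨e₃, m₃, h₃⟩ := h.surj c (by omega)
  have n₁ := h.notMem_boundRows hc m₁ (Or.inl h₁)
  have n₂ := h.notMem_boundRows hc m₂ (Or.inr h₂)
  have d12 : e₁ ≠ e₂ := by rintro rfl; omega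
  have d13 : e₁ ≠ e₃ := by rintro rfl; omega
  set A := boundRows n c E with hA
  set Φ := closeStage (2 * n) c (stageSum (2 * n) k (c + 1)) with hΦ
  have hcA : c ∈ A ↔ c ∈ E := by simp [hA, boundRows]; omega
  have step1 : ∀ S ∈ Finset.powersetCard 2 E,
      Φ (A \ S) (X + (E.card : ℚ[X]) - 4 - ((A \ S).card : ℚ[X])) =
        if c ∈ E → c ∈ S then stateSum n k (c + 1) (E \ S) else 0 := by
    intro S hS
    rw [Finset.mem_powersetCard] at hS
    have hcard : ((E \ S).card : ℚ[X]) = (E.card : ℚ[X]) - 2 := by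
      have h5 := Finset.card_sdiff_add_card_eq_card hS.1
      rw [← h5, hS.2]; push_cast; ring
    simp only [hΦ, closeStage, Finset.mem_sdiff, hcA]
    by_cases h6 : c ∈ E → c ∈ S
    · rw [if_neg (by tauto), if_pos h6, stateSum, hcard]
      have hcES : c ∉ E \ S := by simp only [Finset.mem_sdiff]; tauto
      by_cases h7 : 2 * n - c ∈ A ∧ 2 * n - c ∉ S
      · have h8 : boundRows n (c + 1) (E \ S) = (A \ S).erase (2 * n - c) := by
          ext i
          simp only [hA, boundRows, Finset.mem_filter, Finset.mem_sdiff, Finset.mem_erase]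
          grind
        have h9 : ((A \ S).card : ℚ[X]) = (((A \ S).erase (2 * n - c)).card : ℚ[X]) + 1 := by
          exact_mod_cast (Finset.card_erase_add_one (Finset.mem_sdiff.2 h7)).symm
        rw [if_pos h7, h8, h9]
        congr 1; ring
      · have h8 : boundRows n (c + 1) (E \ S) = A \ S := by
          ext i
          have : i = 2 * n - c → ¬ (i ∈ A ∧ i ∉ S) := by rintro rfl; exact h7
          simp only [hA, boundRows, Finset.mem_filter, Finset.mem_sdiff] at this ⊢
          grind
        rw [if_neg h7, h8]
        congr 1; ring
    · rw [if_pos (by tauto), if_neg h6]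
  rw [Finset.sum_filter]
  have step2 : ∀ S ∈ Finset.powersetCard 2 E,
      (if c ∈ E → c ∈ S then colWt n c ρ S * stateSum n k (c + 1) (E \ S) else 0) =
      (∏ s ∈ S, ballWt A e₁ e₂ s) *
        Φ (A \ S) (X + (E.card : ℚ[X]) - 4 - ((A \ S).card : ℚ[X])) +
      if S = {e₁, e₃} then
        (X ^ 2 - 2 * X) * Φ A (X + (E.card : ℚ[X]) - 4 - (A.card : ℚ[X])) else 0 := by
    intro S hS
    have h4 : (if c ∈ E → c ∈ S then colWt n c ρ S * stateSum n k (c + 1) (E \ S) else 0) =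
        colWt n c ρ S * Φ (A \ S) (X + (E.card : ℚ[X]) - 4 - ((A \ S).card : ℚ[X])) := by
      rw [step1 S hS]; split_ifs <;> simp
    rw [h4, (colWt_eq h hc hcn m₁ m₂ m₃ h₁ h₂ h₃ hS).2, add_mul]
    congr 1
    by_cases hSe : S = {e₁, e₃}
    · by_cases he : e₃ = c
      · have : c ∈ A := hcA.2 (he ▸ m₃)
        simp [hSe, he, hΦ, closeStage, this]
      · have hAS : A \ S = A := by
          rw [Finset.sdiff_eq_self_iff_disjoint, hSe, Finset.disjoint_right]
          intro i
          simp only [Finset.mem_insert, Finset.mem_singleton]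
          rintro (rfl | rfl)
          · exact n₁
          · intro hi
            simp only [hA, boundRows, Finset.mem_filter] at hi
            exact he ((h.fix _ hi.1 hi.2.1).symm.trans h₃)
        rw [if_pos ⟨he, hSe⟩, if_pos hSe, hAS]
    · rw [if_neg (by tauto), if_neg hSe, zero_mul]
  rw [Finset.sum_congr rfl step2, Finset.sum_add_distrib, Finset.sum_ite_eq', if_pos]
  · have h5 := two_mul_sum_ballWt (boundRows_subset n c E) (Finset.mem_sdiff.2 ⟨m₁, n₁⟩)
      (Finset.mem_sdiff.2 ⟨m₂, n₂⟩) d12 Φ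
    rw [stateSum, stageSum]
    rw [← hA] at h5 ⊢
    simp only [← hΦ]
    have h2 : (C (1 / 2 : ℚ)) * 2 = 1 := by
      rw [show (2 : ℚ[X]) = C 2 by rfl, ← C_mul]; norm_num
    generalize ∑ S ∈ Finset.powersetCard 2 E, (∏ s ∈ S, ballWt A e₁ e₂ s) *
        Φ (A \ S) (X + (E.card : ℚ[X]) - 4 - ((A \ S).card : ℚ[X])) = s at h5 ⊢
    generalize Φ A (X + (E.card : ℚ[X]) - 4 - (A.card : ℚ[X])) = t at h5 ⊢
    linear_combination C (1 / 2 : ℚ) * h5 - (s + (X ^ 2 - 2 * X) * t) * h2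
  · rw [Finset.mem_powersetCard, Finset.card_pair d13]
    refine ⟨?_, rfl⟩
    intro i; simp only [Finset.mem_insert, Finset.mem_singleton]
    rintro (rfl | rfl) <;> assumption

/-- A configuration whose columns before `c` are filled. -/
structure IsPartial (n c : ℕ) (U : Finset (ℕ × ℕ)) : Prop where
  mem : ∀ p ∈ U, 1 ≤ p.1 ∧ p.1 < c ∧ p.1 ≤ p.2 ∧ p.2 ≤ 2 * n
  inj : ∀ p ∈ U, ∀ q ∈ U, p.2 = q.2 → p = q
  two : ∀ j, 1 ≤ j → j < c → (U.filter fun p => p.1 = j).card = 2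
  filled : ∀ i, 1 ≤ i → i < c → ∃ p ∈ U, p.2 = i

/-- The rows that are relabelled by `rStep (2 * n) c`. -/
def movedRows (n c : ℕ) : Finset ℕ :=
  (Finset.Icc 1 (2 * n)).filter fun x => x < c ∨ (2 * n < x + c ∧ x < 2 * n)

lemma mem_movedRows {n c x : ℕ} :
    x ∈ movedRows n c ↔ (1 ≤ x ∧ x ≤ 2 * n) ∧ (x < c ∨ (2 * n < x + c ∧ x < 2 * n)) := by
  simp [movedRows]

lemma IsPartial.column {n c : ℕ} {U : Finset (ℕ × ℕ)} (h : IsPartial n c U) {j : ℕ} (h1 : 1 ≤ j)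
    (hj : j < c) : ∃ a b, a < b ∧ (∀ i, (j, i) ∈ U ↔ i = a ∨ i = b) ∧
      lowRow U j = a ∧ upRow U j = b := by
  obtain ⟨p, q, hpq, he⟩ := Finset.card_eq_two.1 (h.two j h1 hj)
  have hmem : ∀ r, r ∈ U ∧ r.1 = j ↔ r = p ∨ r = q := fun r => by
    have := Finset.ext_iff.1 he r
    simpa using this
  obtain ⟨p1, p2⟩ := p
  obtain ⟨q1, q2⟩ := q
  have hp := (hmem _).2 (Or.inl rfl)
  have hq := (hmem _).2 (Or.inr rfl)
  obtain rfl : p1 = j := hp.2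
  obtain rfl : q1 = p1 := hq.2
  have hne : p2 ≠ q2 := by rintro rfl; exact hpq rfl
  have hi : ∀ i, (q1, i) ∈ U ↔ i = p2 ∨ i = q2 := fun i => by
    have := hmem (q1, i); simpa using this
  have hset : ∀ a b, a < b → (∀ i, (q1, i) ∈ U ↔ i = a ∨ i = b) →
      lowRow U q1 = a ∧ upRow U q1 = b := by
    intro a b hab hi
    have : {i | (q1, i) ∈ U} = {a, b} := by ext i; simp [hi]
    rw [lowRow, upRow, this, csInf_pair, csSup_pair]
    exact ⟨min_eq_left hab.le, max_eq_right hab.le⟩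
  rcases lt_or_gt_of_ne hne with hlt | hlt
  · exact ⟨p2, q2, hlt, hi, hset _ _ hlt hi⟩
  · have hi' : ∀ i, (q1, i) ∈ U ↔ i = q2 ∨ i = p2 := fun i => (hi i).trans or_comm
    exact ⟨q2, p2, hlt, hi', hset _ _ hlt hi'⟩

lemma rStep_low {n c x : ℕ} (U : Finset (ℕ × ℕ)) (hcn : c ≤ n) (h1 : 1 ≤ x) (hx : x < c) :
    rStep (2 * n) c U x = lowRow U x := by
  rw [rStep, if_neg (by omega), if_neg (by omega)]

lemma rStep_up {n c j : ℕ} (U : Finset (ℕ × ℕ)) (hcn : c ≤ n) (h1 : 1 ≤ j) (hj : j < c) :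
    rStep (2 * n) c U (2 * n - j) = upRow U j := by
  rw [rStep, if_neg (by omega), if_pos (by omega)]
  congr 1; omega

lemma rStep_fixed {n c x : ℕ} (U : Finset (ℕ × ℕ)) (hx : x ∈ Finset.Icc 1 (2 * n) \ movedRows n c)
    (hcn : c ≤ n) :
    rStep (2 * n) c U x = x := by
  rw [Finset.mem_sdiff, mem_movedRows, Finset.mem_Icc] at hx
  rw [rStep, if_pos (by omega)]

lemma IsPartial.exists_rStep_eq {n c c' : ℕ} {T : Finset (ℕ × ℕ)} (h : IsPartial n c' T)
    (hcn : c ≤ n) {p : ℕ × ℕ} (hp : p ∈ T) (hpc : p.1 < c) :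
    ∃ x ∈ movedRows n c, rStep (2 * n) c T x = p.2 ∧
      ((x = p.1 ∧ ¬ IsUpper T p) ∨ (x = 2 * n - p.1 ∧ IsUpper T p)) := by
  obtain ⟨j, i⟩ := p
  have h1 := h.mem _ hp
  simp only at h1 hpc
  obtain ⟨a, b, hab, hi, hl, hu⟩ := h.column h1.1 h1.2.1
  rcases (hi i).1 hp with rfl | rfl
  · refine ⟨j, by rw [mem_movedRows]; omega, by rw [rStep_low T hcn h1.1 hpc, hl], Or.inl ⟨rfl, ?_⟩⟩
    rintro ⟨⟨u, v⟩, hq, rfl, hlt⟩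
    simp only at hlt hi
    rcases (hi v).1 hq with rfl | rfl <;> omega
  · refine ⟨2 * n - j, by rw [mem_movedRows]; omega, by rw [rStep_up T hcn h1.1 hpc, hu],
      Or.inr ⟨rfl, (j, a), (hi a).2 (Or.inl rfl), rfl, hab⟩⟩

lemma IsPartial.rStep_mem {n c c' : ℕ} {T : Finset (ℕ × ℕ)} (h : IsPartial n c' T)
    (hcc : c ≤ c') (hcn : c ≤ n) {x : ℕ} (hx : x ∈ movedRows n c) :
    ∃ p ∈ T, p.1 < c ∧ p.2 = rStep (2 * n) c T x ∧
      ((x = p.1 ∧ ¬ IsUpper T p) ∨ (x = 2 * n - p.1 ∧ IsUpper T p)) := by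
  rw [mem_movedRows] at hx
  rcases hx.2 with hx2 | hx2
  · obtain ⟨a, b, hab, hi, hl, hu⟩ := h.column hx.1.1 (hx2.trans_le hcc)
    refine ⟨(x, a), (hi a).2 (Or.inl rfl), hx2, by rw [rStep_low T hcn hx.1.1 hx2, hl],
      Or.inl ⟨rfl, ?_⟩⟩
    rintro ⟨⟨u, v⟩, hq, rfl, hlt⟩
    simp only at hlt hi
    rcases (hi v).1 hq with rfl | rfl <;> omega
  · obtain ⟨j, hj⟩ : ∃ j, j = 2 * n - x := ⟨_, rfl⟩
    obtain rfl : x = 2 * n - j := by omega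
    obtain ⟨a, b, hab, hi, hl, hu⟩ := h.column (j := j) (by omega) (by omega)
    exact ⟨(j, b), (hi b).2 (Or.inr rfl), by simp only; omega,
      by rw [rStep_up T hcn (by omega) (by omega), hu],
      Or.inr ⟨rfl, (j, a), (hi a).2 (Or.inl rfl), rfl, hab⟩⟩

lemma IsPartial.rStep_injOn {n c c' : ℕ} {T : Finset (ℕ × ℕ)} (h : IsPartial n c' T)
    (hcc : c ≤ c') (hcn : c ≤ n) : Set.InjOn (rStep (2 * n) c T) (movedRows n c) := by
  intro x hx y hy hxy
  obtain ⟨p, hp, -, hpx, hp'⟩ := h.rStep_mem hcc hcn hx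
  obtain ⟨q, hq, -, hqy, hq'⟩ := h.rStep_mem hcc hcn hy
  obtain rfl := h.inj p hp q hq (by rw [hpx, hqy, hxy])
  rcases hp' with ⟨e1, u1⟩ | ⟨e1, u1⟩ <;> rcases hq' with ⟨e2, u2⟩ | ⟨e2, u2⟩
  · omega
  · exact absurd u2 u1
  · exact absurd u1 u2
  · omega

lemma exists_iterate_mem_sdiff {X D : Finset ℕ} {β : ℕ → ℕ} (hmaps : ∀ x ∈ D, β x ∈ X)
    (hinj : Set.InjOn β D) {i : ℕ} (hiX : i ∈ X) (hi : ∀ x ∈ D, β x ≠ i) :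
    ∃ k, β^[k] i ∈ X \ D ∧ ∀ m < k, β^[m] i ∈ D := by
  have hex : ∃ k, β^[k] i ∉ D := by
    by_contra! hall
    have hne : ∀ a b, a < b → β^[a] i ≠ β^[b] i := by
      intro a
      induction a with
      | zero =>
        intro b hb
        obtain ⟨b, rfl⟩ := Nat.exists_eq_succ_of_ne_zero hb.ne'
        rw [Function.iterate_succ_apply']
        exact (hi _ (hall b)).symm
      | succ a ih =>
        intro b hb
        obtain ⟨b, rfl⟩ := Nat.exists_eq_succ_of_ne_zero (Nat.ne_zero_of_lt hb)
        rw [Function.iterate_succ_apply', Function.iterate_succ_apply']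
        exact fun hh => ih b (by omega) (hinj (hall a) (hall b) hh)
    have hinj' : Function.Injective fun k => β^[k] i := by
      intro a b hab
      by_contra hne'
      rcases lt_or_gt_of_ne hne' with hlt | hlt
      · exact hne _ _ hlt hab
      · exact hne _ _ hlt hab.symm
    exact Set.infinite_of_injective_forall_mem hinj' hall D.finite_toSet
  refine ⟨Nat.find hex, ?_, fun m hm => not_not.1 (Nat.find_min hex hm)⟩
  refine Finset.mem_sdiff.2 ⟨?_, Nat.find_spec hex⟩
  rcases hk : Nat.find hex with _ | k
  · exact hiX
  · rw [Function.iterate_succ_apply']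
    exact hmaps _ (not_not.1 (Nat.find_min hex (by omega)))

lemma eq_of_iterate_eq {D : Finset ℕ} {β : ℕ → ℕ} (hinj : Set.InjOn β D) {i j : ℕ}
    (hi : ∀ x ∈ D, β x ≠ i) (hj : ∀ x ∈ D, β x ≠ j) (k l : ℕ) :
    (∀ m < k, β^[m] i ∈ D) → (∀ m < l, β^[m] j ∈ D) → β^[k] i = β^[l] j → i = j := by
  induction k generalizing l with
  | zero =>
    rcases l with _ | l
    · intro _ _ h; exact h
    · intro _ hl h
      rw [Function.iterate_succ_apply'] at h
      exact absurd h.symm (hi _ (hl l (by omega)))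
  | succ k ih =>
    rcases l with _ | l
    · intro hk _ h
      rw [Function.iterate_succ_apply'] at h
      exact absurd h (hj _ (hk k (by omega)))
    · intro hk hl h
      rw [Function.iterate_succ_apply', Function.iterate_succ_apply'] at h
      exact ih l (fun m hm => hk m (by omega)) (fun m hm => hl m (by omega))
        (hinj (hk k (by omega)) (hl l (by omega)) h)

lemma rootVal_eq {n c : ℕ} {T : Finset (ℕ × ℕ)} (hcn : c ≤ n) {i k : ℕ}
    (hk : (rStep (2 * n) c T)^[k] i ∈ Finset.Icc 1 (2 * n) \ movedRows n c) :
    rootVal (2 * n) c T i = (rStep (2 * n) c T)^[k] i := by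
  have hconst : ∀ m, (rStep (2 * n) c T)^[k + m] i = (rStep (2 * n) c T)^[k] i := by
    intro m
    induction m with
    | zero => rfl
    | succ m ih => rw [← add_assoc, Function.iterate_succ_apply', ih, rStep_fixed T hk hcn]
  have hex : ∃ v, ∃ N, ∀ m ≥ N, (rStep (2 * n) c T)^[m] i = v :=
    ⟨(rStep (2 * n) c T)^[k] i, k, fun m hm => by
      rw [← hconst (m - k), Nat.add_sub_cancel' hm]⟩
  rw [rootVal, dif_pos hex]
  obtain ⟨N, hN⟩ := hex.choose_spec
  rw [← hN (k + N) (by omega), hconst]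

lemma IsPartial.exists_root {n c c' : ℕ} {T : Finset (ℕ × ℕ)} (h : IsPartial n c' T)
    (hcc : c ≤ c') (hcn : c ≤ n) {i : ℕ} (hi : i ∈ Finset.Icc 1 (2 * n))
    (hiT : ∀ p ∈ T, p.2 = i → c ≤ p.1) :
    ∃ k, rootVal (2 * n) c T i = (rStep (2 * n) c T)^[k] i ∧
      rootVal (2 * n) c T i ∈ Finset.Icc 1 (2 * n) \ movedRows n c ∧
      ∀ m < k, (rStep (2 * n) c T)^[m] i ∈ movedRows n c := by
  obtain ⟨k, hk, hm⟩ := exists_iterate_mem_sdiff (X := Finset.Icc 1 (2 * n)) (fun x hx => by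
      obtain ⟨p, hp, -, hpx, -⟩ := h.rStep_mem hcc hcn hx
      rw [← hpx, Finset.mem_Icc]; have := h.mem p hp; omega)
    (h.rStep_injOn hcc hcn) hi (fun x hx hh => by
      obtain ⟨p, hp, hpc, hpx, -⟩ := h.rStep_mem hcc hcn hx
      exact absurd (hiT p hp (hpx.trans hh)) (by omega))
  have := rootVal_eq hcn hk
  exact ⟨k, this, this ▸ hk, hm⟩

/-- Rows in `[1, 2n]` containing no point. -/
def emptyRows (n : ℕ) (U : Finset (ℕ × ℕ)) : Finset ℕ :=
  Finset.Icc 1 (2 * n) \ U.image Prod.snd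

lemma mem_emptyRows {n : ℕ} {U : Finset (ℕ × ℕ)} {i : ℕ} :
    i ∈ emptyRows n U ↔ (1 ≤ i ∧ i ≤ 2 * n) ∧ ∀ p ∈ U, p.2 ≠ i := by
  simp only [emptyRows, Finset.mem_sdiff, Finset.mem_Icc, Finset.mem_image, not_exists, not_and,
    ne_eq]

lemma IsPartial.card_emptyRows {n c : ℕ} {U : Finset (ℕ × ℕ)} (h : IsPartial n c U)
    (hc : 1 ≤ c) : (emptyRows n U).card + 2 * c = 2 * n + 2 := by
  have h1 : U.card = 2 * (c - 1) := by
    rw [Finset.card_eq_sum_card_fiberwise (f := Prod.fst) (t := Finset.Ico 1 c),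
      Finset.sum_congr rfl (g := fun _ => 2)]
    · simp; ring
    · intro j hj; rw [Finset.mem_Ico] at hj; exact h.two j hj.1 hj.2
    · intro p hp
      have := h.mem p hp
      simp; omega
  have h2 : (U.image Prod.snd).card = U.card :=
    Finset.card_image_of_injOn fun p hp q hq hpq => h.inj p hp q hq hpq
  have h3 : U.image Prod.snd ⊆ Finset.Icc 1 (2 * n) := by
    intro i hi
    obtain ⟨p, hp, rfl⟩ := Finset.mem_image.1 hi
    have := h.mem p hp
    rw [Finset.mem_Icc]; omega
  have h4 := Finset.card_sdiff_add_card_eq_card h3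
  rw [Nat.card_Icc] at h4
  rw [emptyRows]
  omega

lemma IsPartial.isRootMap {n c : ℕ} {U : Finset (ℕ × ℕ)} (h : IsPartial n c U) (hc : 1 ≤ c)
    (hcn : c ≤ n) : IsRootMap n c (emptyRows n U) (rootVal (2 * n) c U) := by
  have hroot : ∀ i ∈ emptyRows n U, ∃ k, rootVal (2 * n) c U i = (rStep (2 * n) c U)^[k] i ∧
      rootVal (2 * n) c U i ∈ Finset.Icc 1 (2 * n) \ movedRows n c ∧
      ∀ m < k, (rStep (2 * n) c U)^[m] i ∈ movedRows n c := fun i hi => by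
    rw [mem_emptyRows] at hi
    exact h.exists_root le_rfl hcn (Finset.mem_Icc.2 hi.1) fun p hp hpi => absurd hpi (hi.2 p hp)
  have hne : ∀ i ∈ emptyRows n U, ∀ x ∈ movedRows n c, rStep (2 * n) c U x ≠ i := by
    intro i hi x hx hh
    obtain ⟨p, hp, -, hpx, -⟩ := h.rStep_mem le_rfl hcn hx
    exact (mem_emptyRows.1 hi).2 p hp (hpx.trans hh)
  have hmem : ∀ i ∈ emptyRows n U, c ≤ i ∧ i ≤ 2 * n := by
    intro i hi
    rw [mem_emptyRows] at hi
    refine ⟨?_, hi.1.2⟩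
    by_contra hlt
    obtain ⟨p, hp, hpi⟩ := h.filled i hi.1.1 (by omega)
    exact hi.2 p hp hpi
  have hinj : Set.InjOn (rootVal (2 * n) c U) (emptyRows n U) := by
    intro i hi j hj hij
    obtain ⟨k, hk, -, hkm⟩ := hroot i hi
    obtain ⟨l, hl, -, hlm⟩ := hroot j hj
    exact eq_of_iterate_eq (h.rStep_injOn le_rfl hcn) (hne i hi) (hne j hj) k l hkm hlm
      (by rw [← hk, ← hl, hij])
  have hcard := h.card_emptyRows hc
  have hfix : (Finset.Icc 1 (2 * n) \ movedRows n c) =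
      insert (2 * n) (Finset.Icc c (2 * n - c)) := by
    ext x
    simp only [Finset.mem_sdiff, mem_movedRows, Finset.mem_Icc, Finset.mem_insert]
    omega
  refine ⟨hmem, hcard, hinj, fun l hl => ?_, fun i hi hic => ?_⟩
  · have := Finset.surj_on_of_inj_on_of_card_le (s := emptyRows n U)
      (t := Finset.Icc 1 (2 * n) \ movedRows n c) (fun i _ => rootVal (2 * n) c U i)
      (fun i hi => (hroot i hi).choose_spec.2.1) (fun i j hi hj hij => hinj hi hj hij)
      (by
        rw [hfix, Finset.card_insert_of_notMem (by simp; omega), Nat.card_Icc]; omega) l (by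
        rw [hfix, Finset.mem_insert, Finset.mem_Icc]; omega)
    obtain ⟨i, hi, hil⟩ := this
    exact ⟨i, hi, hil.symm⟩
  · have h2 := hmem i hi
    exact rootVal_eq (k := 0) hcn (by
      simp only [Function.iterate_zero, id, Finset.mem_sdiff, mem_movedRows, Finset.mem_Icc]; omega)

lemma IsPartial.emptyRows_eq_empty {n : ℕ} {T : Finset (ℕ × ℕ)} (h : IsPartial n (n + 1) T) :
    emptyRows n T = ∅ := by
  have := h.card_emptyRows (by omega)
  exact Finset.card_eq_zero.1 (by omega)

lemma IsPartial.rowPt_eq {n c : ℕ} {T : Finset (ℕ × ℕ)} (h : IsPartial n c T) {p : ℕ × ℕ}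
    (hp : p ∈ T) : rowPt T p.2 = p := by
  have hex : ∃ q ∈ T, q.2 = p.2 := ⟨p, hp, rfl⟩
  rw [rowPt, dif_pos hex]
  exact h.inj _ hex.choose_spec.1 _ hp hex.choose_spec.2

lemma IsPartial.exists_row {n : ℕ} {T : Finset (ℕ × ℕ)} (h : IsPartial n (n + 1) T) {r : ℕ}
    (h1 : 1 ≤ r) (h2 : r ≤ 2 * n) : ∃ p ∈ T, p.2 = r := by
  by_contra! hne
  have : r ∈ emptyRows n T := mem_emptyRows.2 ⟨⟨h1, h2⟩, hne⟩
  rw [h.emptyRows_eq_empty] at this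
  exact Finset.notMem_empty _ this

lemma IsPartial.rowPt_mem {n : ℕ} {T : Finset (ℕ × ℕ)} (h : IsPartial n (n + 1) T) {r : ℕ}
    (h1 : 1 ≤ r) (h2 : r ≤ 2 * n) : rowPt T r ∈ T ∧ (rowPt T r).2 = r := by
  obtain ⟨p, hp, rfl⟩ := h.exists_row h1 h2
  rw [h.rowPt_eq hp]
  exact ⟨hp, rfl⟩

lemma mem_TneF {n : ℕ} {T : Finset (ℕ × ℕ)} : T ∈ TneF n ↔ IsPartial n (n + 1) T := by
  simp only [TneF, Finset.mem_filter, Finset.mem_powerset]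
  constructor
  · rintro ⟨-, h1, h2, h3⟩
    refine ⟨fun p hp => ?_, fun p hp q hq hpq => ?_, fun j hj hjn => ?_, fun i hi hin => ?_⟩
    · have := h1 p hp; omega
    · have := h1 p hp
      exact Finset.card_le_one.1 (h2 p.2 (Finset.mem_Icc.2 ⟨by omega, by omega⟩)).le p
        (Finset.mem_filter.2 ⟨hp, rfl⟩) q (Finset.mem_filter.2 ⟨hq, hpq.symm⟩)
    · exact h3 j (Finset.mem_Icc.2 ⟨hj, by omega⟩)
    · obtain ⟨p, hp⟩ := Finset.card_pos.1
        (by rw [h2 i (Finset.mem_Icc.2 ⟨hi, by omega⟩)]; exact one_pos)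
      exact ⟨p, Finset.mem_filter.1 hp⟩
  · intro h
    refine ⟨fun p hp => ?_, fun p hp => ?_, fun i hi => ?_, fun j hj => ?_⟩
    · have := h.mem p hp
      rw [Finset.mem_product, Finset.mem_Icc, Finset.mem_Icc]; omega
    · have := h.mem p hp
      omega
    · rw [Finset.mem_Icc] at hi
      obtain ⟨p, hp, hpi⟩ := h.exists_row hi.1 hi.2
      refine Finset.card_eq_one.2 ⟨p, ?_⟩
      ext q
      simp only [Finset.mem_filter, Finset.mem_singleton]
      exact ⟨fun hq => h.inj q hq.1 p hp (hq.2.trans hpi.symm), fun hq => hq ▸ ⟨hp, hpi⟩⟩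
    · rw [Finset.mem_Icc] at hj
      exact h.two j hj.1 (by omega)

/-- The points of `T` in the columns before `c`. -/
def truncCols (c : ℕ) (T : Finset (ℕ × ℕ)) : Finset (ℕ × ℕ) := T.filter fun p => p.1 < c

lemma mem_truncCols {c : ℕ} {T : Finset (ℕ × ℕ)} {p : ℕ × ℕ} :
    p ∈ truncCols c T ↔ p ∈ T ∧ p.1 < c := Finset.mem_filter

lemma IsPartial.truncCols {n c c' : ℕ} {T : Finset (ℕ × ℕ)} (h : IsPartial n c' T)
    (hc : c ≤ c') : IsPartial n c (truncCols c T) := by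
  refine ⟨fun p hp => ?_, fun p hp q hq => ?_, fun j hj hjc => ?_, fun i hi hic => ?_⟩
  · rw [mem_truncCols] at hp
    have := h.mem p hp.1
    omega
  · exact h.inj p (mem_truncCols.1 hp).1 q (mem_truncCols.1 hq).1
  · rw [← h.two j hj (by omega), SymDellac.truncCols, Finset.filter_filter]
    congr 1
    exact Finset.filter_congr fun p _ => ⟨fun hp => hp.2, fun hp => ⟨by omega, hp⟩⟩
  · obtain ⟨p, hp, rfl⟩ := h.filled i hi (by omega)
    have := h.mem p hp
    exact ⟨p, mem_truncCols.2 ⟨hp, by omega⟩, rfl⟩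

lemma IsPartial.rootVal_truncCols {n c c' : ℕ} {T : Finset (ℕ × ℕ)} (h : IsPartial n c' T) :
    rootVal (2 * n) c (SymDellac.truncCols c T) = rootVal (2 * n) c T := by
  have hset : ∀ x, x < c ∨ 2 * n < x →
      {i | (x, i) ∈ SymDellac.truncCols c T} = {i | (x, i) ∈ T} := by
    intro x hx
    ext i
    simp only [Set.mem_ofPred_eq, mem_truncCols, and_iff_left_iff_imp]
    intro hi
    have := h.mem _ hi
    omega
  have hstep : rStep (2 * n) c (SymDellac.truncCols c T) = rStep (2 * n) c T := by
    funext x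
    unfold rStep
    split_ifs with h1 h2
    · rfl
    · rw [upRow, upRow, hset _ (by omega)]
    · rw [lowRow, lowRow, hset _ (by omega)]
  funext i
  simp only [rootVal, hstep]

lemma IsPartial.stepE_rowPt {n c : ℕ} {T : Finset (ℕ × ℕ)} (h : IsPartial n (n + 1) T)
    (hcn : c ≤ n) {x : ℕ} (hx : x ∈ movedRows n c) :
    stepE n T (rowPt T (rStep (2 * n) c T x)) = rowPt T x ∧
      (rowPt T (rStep (2 * n) c T x)).1 < c := by
  obtain ⟨p, hp, hpc, hpx, hp'⟩ := h.rStep_mem (by omega) hcn hx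
  rw [← hpx, h.rowPt_eq hp]
  refine ⟨?_, hpc⟩
  rw [stepE, if_neg (by omega)]
  rcases hp' with ⟨rfl, hu⟩ | ⟨rfl, hu⟩
  · rw [if_neg hu]
  · rw [if_pos hu]

lemma pathE_succ (n : ℕ) (T : Finset (ℕ × ℕ)) {l x : ℕ} (h : stepE n T (rowPt T l) = rowPt T x)
    (k : ℕ) : pathE n T l (k + 1) = pathE n T x k := by
  rw [pathE, pathE, Function.iterate_succ_apply, h]

lemma IsPartial.iterate_of_pathE {n c i : ℕ} {T : Finset (ℕ × ℕ)} (h : IsPartial n (n + 1) T)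
    (hcn : c ≤ n) (k : ℕ) : ∀ l, 1 ≤ l → l ≤ 2 * n → pathE n T l k = (c, i) →
      (∀ m < k, (pathE n T l m).1 < c) → (rStep (2 * n) c T)^[k] i = l := by
  induction k with
  | zero =>
    intro l h1 h2 hp _
    rw [← (h.rowPt_mem h1 h2).2]
    exact (congrArg Prod.snd hp).symm
  | succ k ih =>
    intro l h1 h2 hp hm
    obtain ⟨hl, hl2⟩ := h.rowPt_mem h1 h2
    obtain ⟨x, hx, hxl, -⟩ := h.exists_rStep_eq hcn hl (hm 0 (by omega))
    rw [hl2] at hxl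
    have hs := (h.stepE_rowPt hcn hx).1
    rw [hxl] at hs
    have hx' := (mem_movedRows.1 hx).1
    rw [Function.iterate_succ_apply', ih x hx'.1 hx'.2 (by rw [← pathE_succ n T hs, hp])
      (fun m hmk => by rw [← pathE_succ n T hs]; exact hm _ (by omega)), hxl]

lemma IsPartial.pathE_of_iterate {n c i : ℕ} {T : Finset (ℕ × ℕ)} (h : IsPartial n (n + 1) T)
    (hcn : c ≤ n) (hi : (c, i) ∈ T) (k : ℕ) :
    (∀ m < k, (rStep (2 * n) c T)^[m] i ∈ movedRows n c) →
      pathE n T ((rStep (2 * n) c T)^[k] i) k = (c, i) ∧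
      ∀ m < k, (pathE n T ((rStep (2 * n) c T)^[k] i) m).1 < c := by
  induction k with
  | zero => exact fun _ => ⟨h.rowPt_eq hi, fun m hm => absurd hm (by omega)⟩
  | succ k ih =>
    intro hm
    obtain ⟨ih1, ih2⟩ := ih fun m hmk => hm m (by omega)
    obtain ⟨hs, hs1⟩ := h.stepE_rowPt hcn (hm k (by omega))
    rw [Function.iterate_succ_apply']
    refine ⟨(pathE_succ n T hs k).trans ih1, fun m hmk => ?_⟩
    rcases m with _ | m
    · exact hs1
    · rw [pathE_succ n T hs]
      exact ih2 m (by omega)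

lemma IsPartial.mem_recSetE {n c i l : ℕ} {T : Finset (ℕ × ℕ)} (h : IsPartial n (n + 1) T)
    (hcn : c ≤ n) (hi : (c, i) ∈ T) (hl : l = n ∨ l = 2 * n) :
    (c, i) ∈ recSetE n T l ↔ rootVal (2 * n) c T i = l := by
  have hm := h.mem _ hi
  constructor
  · rintro ⟨k, hk, hlt⟩
    have := h.iterate_of_pathE hcn k l (by omega) (by omega) hk hlt
    rw [rootVal_eq hcn (k := k), this]
    rw [this, Finset.mem_sdiff, mem_movedRows, Finset.mem_Icc]
    omega
  · rintro rfl
    obtain ⟨k, hk, -, hkm⟩ := h.exists_root (c := c) (i := i) (by omega) hcn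
      (Finset.mem_Icc.2 ⟨by omega, by omega⟩) fun p hp hpi => by
        rw [h.inj p hp _ hi hpi]
    rw [hk]
    exact ⟨k, h.pathE_of_iterate hcn hi k hkm⟩

lemma IsPartial.recSetE_subset {n l : ℕ} {T : Finset (ℕ × ℕ)} (h : IsPartial n (n + 1) T)
    (h1 : 1 ≤ l) (h2 : l ≤ 2 * n) : recSetE n T l ⊆ T := by
  rintro p ⟨k, rfl, -⟩
  induction k with
  | zero => exact (h.rowPt_mem h1 h2).1
  | succ k ih =>
    rw [pathE, Function.iterate_succ_apply', ← pathE]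
    have := h.mem _ ih
    rw [stepE]
    split_ifs
    · exact ih
    · exact (h.rowPt_mem (by omega) (by omega)).1
    · exact (h.rowPt_mem (by omega) (by omega)).1

/-- The rows of the points of `T` in column `c`. -/
def colRows (T : Finset (ℕ × ℕ)) (c : ℕ) : Finset ℕ := (T.filter fun p => p.1 = c).image Prod.snd

lemma mem_colRows {T : Finset (ℕ × ℕ)} {c i : ℕ} : i ∈ colRows T c ↔ (c, i) ∈ T := by
  simp only [colRows, Finset.mem_image, Finset.mem_filter]
  constructor
  · rintro ⟨⟨a, b⟩, ⟨hp, rfl⟩, rfl⟩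
    exact hp
  · intro hi
    exact ⟨(c, i), ⟨hi, rfl⟩, rfl⟩

lemma card_eq_sum_colRows (A : Finset (ℕ × ℕ)) (s : Finset ℕ) (h : ∀ p ∈ A, p.1 ∈ s) :
    A.card = ∑ c ∈ s, (colRows A c).card := by
  rw [Finset.card_eq_sum_card_fiberwise (f := Prod.fst) (t := s) h]
  refine Finset.sum_congr rfl fun c _ => (Finset.card_image_of_injOn ?_).symm
  intro p hp q hq hpq
  rw [Finset.mem_coe, Finset.mem_filter] at hp hq
  exact Prod.ext (hp.2.trans hq.2.symm) hpq

lemma card_filter_eq_sum (T : Finset (ℕ × ℕ)) (s : Finset ℕ) (h : ∀ p ∈ T, p.1 ∈ s)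
    (q : ℕ × ℕ → Prop) [DecidablePred q] :
    (T.filter q).card = ∑ c ∈ s, ((colRows T c).filter fun i => q (c, i)).card := by
  rw [card_eq_sum_colRows _ s fun p hp => h p (Finset.mem_filter.1 hp).1]
  refine Finset.sum_congr rfl fun c _ => congrArg _ ?_
  ext i
  simp only [mem_colRows, Finset.mem_filter]

lemma IsPartial.colRows_mem {n c : ℕ} {T : Finset (ℕ × ℕ)} (h : IsPartial n (n + 1) T)
    (hc : 1 ≤ c) (hcn : c ≤ n) :
    colRows T c ∈ Finset.powersetCard 2 (emptyRows n (SymDellac.truncCols c T)) := by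
  rw [Finset.mem_powersetCard]
  constructor
  · intro i hi
    rw [mem_colRows] at hi
    have := h.mem _ hi
    refine mem_emptyRows.2 ⟨by omega, fun p hp hpi => ?_⟩
    rw [mem_truncCols] at hp
    rw [h.inj p hp.1 _ hi hpi] at hp
    omega
  · rw [← h.two c hc (by omega), colRows]
    refine Finset.card_image_of_injOn fun p hp q hq hpq => ?_
    exact h.inj p (Finset.mem_filter.1 hp).1 q (Finset.mem_filter.1 hq).1 hpq

lemma IsPartial.isRootMap_truncCols {n c : ℕ} {T : Finset (ℕ × ℕ)} (h : IsPartial n (n + 1) T)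
    (hc : 1 ≤ c) (hcn : c ≤ n) :
    IsRootMap n c (emptyRows n (SymDellac.truncCols c T)) (rootVal (2 * n) c T) :=
  h.rootVal_truncCols ▸ (h.truncCols (by omega)).isRootMap hc hcn

lemma IsPartial.colMax_le {n c : ℕ} {T : Finset (ℕ × ℕ)} (h : IsPartial n (n + 1) T)
    (hc : 1 ≤ c) (hcn : c < n) :
    colMax n c (rootVal (2 * n) c T) (colRows T c) ≤ colFree n c (colRows T c) := by
  have hr := h.isRootMap_truncCols hc hcn.le
  obtain ⟨e₁, m₁, h₁⟩ := hr.surj n (by omega)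
  obtain ⟨e₂, m₂, h₂⟩ := hr.surj (2 * n) (by omega)
  obtain ⟨e₃, m₃, h₃⟩ := hr.surj c (by omega)
  exact (colWt_eq hr hc hcn m₁ m₂ m₃ h₁ h₂ h₃ (h.colRows_mem hc hcn.le)).1

lemma IsPartial.colRows_last {n : ℕ} {T : Finset (ℕ × ℕ)} (h : IsPartial n (n + 1) T)
    (hn : 1 ≤ n) : colRows T n = emptyRows n (SymDellac.truncCols n T) := by
  have h1 := Finset.mem_powersetCard.1 (h.colRows_mem hn le_rfl)
  have h2 := (h.isRootMap_truncCols hn le_rfl).card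
  exact Finset.eq_of_subset_of_card_le h1.1 (by omega)

lemma IsPartial.fst_mem_Icc {n : ℕ} {T : Finset (ℕ × ℕ)} (h : IsPartial n (n + 1) T) :
    ∀ p ∈ T, p.1 ∈ Finset.Icc 1 n := fun p hp => by
  have := h.mem p hp
  rw [Finset.mem_Icc]; omega

lemma IsPartial.frE_add_one {n : ℕ} {T : Finset (ℕ × ℕ)} (h : IsPartial n (n + 1) T)
    (hn : 1 ≤ n) : frE n T = ∑ c ∈ Finset.Ico 1 n, colFree n c (colRows T c) + 1 := by
  have h1 : (T.filter fun p => p.2 = n ∨ 2 * n + 1 ≤ p.2 + p.1).card = frE n T + 1 := by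
    obtain ⟨p, hp, hpn⟩ := h.exists_row hn (by omega)
    have : (T.filter fun p => p.2 = n) = {p} := by
      ext q
      simp only [Finset.mem_filter, Finset.mem_singleton]
      exact ⟨fun hq => h.inj q hq.1 p hp (hq.2.trans hpn.symm), fun hq => hq ▸ ⟨hp, hpn⟩⟩
    rw [Finset.filter_or, Finset.card_union_of_disjoint, this, Finset.card_singleton, add_comm]
    · rfl
    · rw [Finset.disjoint_filter]
      intro q hq hqn
      have := h.mem q hq
      omega
  rw [card_filter_eq_sum T _ h.fst_mem_Icc, ← Finset.sum_Ico_add_eq_sum_Icc hn] at h1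
  have h2 : ((colRows T n).filter fun i => i = n ∨ 2 * n + 1 ≤ i + n).card = 2 := by
    rw [Finset.filter_true_of_mem]
    · exact (Finset.mem_powersetCard.1 (h.colRows_mem hn le_rfl)).2
    · intro i hi
      have := h.mem _ (mem_colRows.1 hi)
      omega
  simp only at h1
  simp only [colFree]
  omega

lemma IsPartial.ncard_recSetE {n l : ℕ} {T : Finset (ℕ × ℕ)} (h : IsPartial n (n + 1) T)
    (hn : 1 ≤ n) (hl : l = n ∨ l = 2 * n) :
    (recSetE n T l).ncard =
      ∑ c ∈ Finset.Ico 1 n, ((colRows T c).filter fun i => rootVal (2 * n) c T i = l).card + 1 := by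
  have h1 : recSetE n T l = (T.filter fun p => p ∈ recSetE n T l : Finset (ℕ × ℕ)) := by
    ext p
    rw [Finset.mem_coe, Finset.mem_filter]
    exact ⟨fun hp => ⟨h.recSetE_subset (by omega) (by omega) hp, hp⟩, fun hp => hp.2⟩
  have h2 : ∀ c ≤ n, ((colRows T c).filter fun i => (c, i) ∈ recSetE n T l) =
      (colRows T c).filter fun i => rootVal (2 * n) c T i = l := fun c hcn =>
    Finset.filter_congr fun i hi => h.mem_recSetE hcn (mem_colRows.1 hi) hl
  have hr := h.isRootMap_truncCols hn le_rfl
  have h3 : ((colRows T n).filter fun i => rootVal (2 * n) n T i = l).card = 1 := by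
    rw [h.colRows_last hn]
    obtain ⟨e, he, hel⟩ := hr.surj l (by omega)
    refine Finset.card_eq_one.2 ⟨e, ?_⟩
    ext i
    simp only [Finset.mem_filter, Finset.mem_singleton]
    exact ⟨fun hi => hr.inj hi.1 he (hi.2.trans hel.symm), fun hi => hi ▸ ⟨he, hel⟩⟩
  rw [h1, Set.ncard_coe_finset, card_filter_eq_sum T _ h.fst_mem_Icc,
    ← Finset.sum_Ico_add_eq_sum_Icc hn, h2 n le_rfl, h3]
  refine congrArg (· + 1) (Finset.sum_congr rfl fun c hc => ?_)
  rw [h2 c (Finset.mem_Ico.1 hc).2.le]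

lemma IsPartial.gStat_eq {n : ℕ} {T : Finset (ℕ × ℕ)} (h : IsPartial n (n + 1) T) (hn : 1 ≤ n) :
    gStat n T = ∑ c ∈ Finset.Ico 1 n, ((colRows T c).filter fun i => 2 * n + 1 ≤ i + c ∧
      (∃ q ∈ colRows T c, q ≠ i ∧ rootVal (2 * n) c T q = n) ∧ rootVal (2 * n) c T i = c).card := by
  have h1 : GsetE n T = (T.filter fun p => p ∈ GsetE n T : Finset (ℕ × ℕ)) := by
    ext p
    rw [Finset.mem_coe, Finset.mem_filter]
    exact ⟨fun hp => ⟨hp.1, hp⟩, fun hp => hp.2⟩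
  have h2 : ∀ c ≤ n, ((colRows T c).filter fun i => (c, i) ∈ GsetE n T) =
      (colRows T c).filter fun i => 2 * n + 1 ≤ i + c ∧
      (∃ q ∈ colRows T c, q ≠ i ∧ rootVal (2 * n) c T q = n) ∧
        rootVal (2 * n) c T i = c := fun c hcn => by
    refine Finset.filter_congr fun i hi => ?_
    rw [mem_colRows] at hi
    simp only [GsetE, Set.mem_ofPred_eq, hi, true_and]
    refine and_congr_right fun _ => and_congr_left fun _ => ?_
    constructor
    · rintro ⟨⟨a, q⟩, hq, rfl, hqi, hqr⟩
      exact ⟨q, mem_colRows.2 hq, fun hh => hqi (by rw [hh]),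
        (h.mem_recSetE hcn hq (Or.inl rfl)).1 hqr⟩
    · rintro ⟨q, hq, hqi, hqr⟩
      rw [mem_colRows] at hq
      exact ⟨(c, q), hq, rfl, fun hh => hqi (congrArg Prod.snd hh),
        (h.mem_recSetE hcn hq (Or.inl rfl)).2 hqr⟩
  have hr := h.isRootMap_truncCols hn le_rfl
  rw [gStat, h1, Set.ncard_coe_finset, card_filter_eq_sum T _ h.fst_mem_Icc,
    ← Finset.sum_Ico_add_eq_sum_Icc hn, h2 n le_rfl, Finset.card_eq_zero.2, add_zero]
  · exact Finset.sum_congr rfl fun c hc => by rw [h2 c (Finset.mem_Ico.1 hc).2.le]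
  · refine Finset.filter_eq_empty_iff.2 ?_
    rintro i hi ⟨-, ⟨q, hq, hqi, hqn⟩, hin⟩
    rw [h.colRows_last hn] at hi hq
    exact hqi (hr.inj hq hi (hqn.trans hin.symm))

lemma IsPartial.maxStat_eq {n : ℕ} {T : Finset (ℕ × ℕ)} (h : IsPartial n (n + 1) T)
    (hn : 1 ≤ n) : maxStat n T =
      ∑ c ∈ Finset.Ico 1 n, colMax n c (rootVal (2 * n) c T) (colRows T c) := by
  simp only [maxStat, bStat, rStat, h.ncard_recSetE hn (Or.inl rfl),
    h.ncard_recSetE hn (Or.inr rfl), h.gStat_eq hn, Nat.add_sub_cancel, colMax,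
    Finset.sum_add_distrib]

lemma IsPartial.maxStat_lt_frE {n : ℕ} {T : Finset (ℕ × ℕ)} (h : IsPartial n (n + 1) T)
    (hn : 1 ≤ n) : maxStat n T + 1 ≤ frE n T := by
  rw [h.maxStat_eq hn, h.frE_add_one hn]
  refine Nat.add_le_add_right (Finset.sum_le_sum fun c hc => ?_) 1
  rw [Finset.mem_Ico] at hc
  exact h.colMax_le hc.1 hc.2

open Polynomial in
lemma IsPartial.weight_eq_prod {n : ℕ} {T : Finset (ℕ × ℕ)} (h : IsPartial n (n + 1) T)
    (hn : 1 ≤ n) :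
    C ((2 : ℚ) ^ (frE n T - 1 - maxStat n T)) * X ^ maxStat n T =
      ∏ c ∈ Finset.Ico 1 n, colWt n c (rootVal (2 * n) c T) (colRows T c) := by
  have h1 : frE n T - 1 - maxStat n T = ∑ c ∈ Finset.Ico 1 n,
      (colFree n c (colRows T c) - colMax n c (rootVal (2 * n) c T) (colRows T c)) := by
    rw [h.frE_add_one hn, h.maxStat_eq hn, Nat.add_sub_cancel, Finset.sum_tsub_distrib]
    intro c hc
    rw [Finset.mem_Ico] at hc
    exact h.colMax_le hc.1 hc.2
  simp only [colWt]
  rw [Finset.prod_mul_distrib, h1, h.maxStat_eq hn, Finset.prod_pow_eq_pow_sum,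
    ← Finset.prod_pow_eq_pow_sum, map_prod]

/-- The configuration `U` with points added in column `c`, in the rows of `S`. -/
def addCol (c : ℕ) (U : Finset (ℕ × ℕ)) (S : Finset ℕ) : Finset (ℕ × ℕ) := U ∪ S.image (Prod.mk c)

lemma mem_addCol {c : ℕ} {U : Finset (ℕ × ℕ)} {S : Finset ℕ} {p : ℕ × ℕ} :
    p ∈ addCol c U S ↔ p ∈ U ∨ (p.1 = c ∧ p.2 ∈ S) := by
  simp only [addCol, Finset.mem_union, Finset.mem_image]
  refine or_congr_right ⟨?_, ?_⟩
  · rintro ⟨i, hi, rfl⟩; exact ⟨rfl, hi⟩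
  · rintro ⟨rfl, hi⟩; exact ⟨p.2, hi, rfl⟩

lemma IsPartial.truncCols_addCol {n c : ℕ} {U : Finset (ℕ × ℕ)} (h : IsPartial n c U)
    (S : Finset ℕ) : SymDellac.truncCols c (addCol c U S) = U := by
  ext p
  rw [mem_truncCols, mem_addCol]
  constructor
  · rintro ⟨hp | hp, hpc⟩
    · exact hp
    · omega
  · exact fun hp => ⟨Or.inl hp, (h.mem p hp).2.1⟩

lemma IsPartial.colRows_addCol {n c : ℕ} {U : Finset (ℕ × ℕ)} (h : IsPartial n c U)
    (S : Finset ℕ) : colRows (addCol c U S) c = S := by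
  ext i
  rw [mem_colRows, mem_addCol]
  constructor
  · rintro (hp | hp)
    · exact absurd (h.mem _ hp).2.1 (lt_irrefl c)
    · exact hp.2
  · exact fun hi => Or.inr ⟨rfl, hi⟩

lemma emptyRows_addCol (n c : ℕ) (U : Finset (ℕ × ℕ)) (S : Finset ℕ) :
    emptyRows n (addCol c U S) = emptyRows n U \ S := by
  ext i
  simp only [mem_emptyRows, Finset.mem_sdiff, mem_addCol]
  constructor
  · rintro ⟨hi, hU⟩
    exact ⟨⟨hi, fun p hp => hU p (Or.inl hp)⟩, fun hS => hU (c, i) (Or.inr ⟨rfl, hS⟩) rfl⟩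
  · rintro ⟨⟨hi, hU⟩, hS⟩
    refine ⟨hi, fun p hp => ?_⟩
    rcases hp with hp | hp
    · exact hU p hp
    · rintro rfl; exact hS hp.2

lemma truncCols_succ (c : ℕ) (T : Finset (ℕ × ℕ)) :
    truncCols (c + 1) T = addCol c (truncCols c T) (colRows T c) := by
  ext ⟨a, i⟩
  simp only [mem_truncCols, mem_addCol, mem_colRows]
  constructor
  · rintro ⟨hp, hc⟩
    rcases Nat.lt_succ_iff_lt_or_eq.1 hc with hc | rfl
    · exact Or.inl ⟨hp, hc⟩
    · exact Or.inr ⟨rfl, hp⟩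
  · rintro (hp | ⟨rfl, hp⟩)
    · exact ⟨hp.1, by omega⟩
    · exact ⟨hp, by omega⟩

lemma truncCols_truncCols {b c : ℕ} (h : b ≤ c) (T : Finset (ℕ × ℕ)) :
    truncCols b (truncCols c T) = truncCols b T := by
  ext p
  simp only [mem_truncCols]
  exact ⟨fun hp => ⟨hp.1.1, hp.2⟩, fun hp => ⟨⟨hp.1, by omega⟩, hp.2⟩⟩

lemma colRows_truncCols {b c : ℕ} (h : b < c) (T : Finset (ℕ × ℕ)) :
    colRows (truncCols c T) b = colRows T b := by
  ext i
  rw [mem_colRows, mem_colRows, mem_truncCols]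
  exact ⟨fun hp => hp.1, fun hp => ⟨hp, h⟩⟩

lemma IsPartial.addCol {n c : ℕ} {U : Finset (ℕ × ℕ)} (h : IsPartial n c U) (hc : 1 ≤ c)
    {S : Finset ℕ} (hS : S ∈ Finset.powersetCard 2 (emptyRows n U))
    (hcS : c ∈ emptyRows n U → c ∈ S) (hcn : c ≤ n) : IsPartial n (c + 1) (addCol c U S) := by
  rw [Finset.mem_powersetCard] at hS
  have hSE : ∀ i ∈ S, (c ≤ i ∧ i ≤ 2 * n) ∧ ∀ p ∈ U, p.2 ≠ i := fun i hi =>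
    ⟨(h.isRootMap hc hcn).mem i (hS.1 hi), (mem_emptyRows.1 (hS.1 hi)).2⟩
  refine ⟨fun p hp => ?_, fun p hp q hq hpq => ?_, fun j hj hjc => ?_, fun i hi hic => ?_⟩
  · rcases mem_addCol.1 hp with hp | hp
    · have := h.mem p hp; omega
    · have := (hSE _ hp.2).1; omega
  · rcases mem_addCol.1 hp with hp | hp <;> rcases mem_addCol.1 hq with hq | hq
    · exact h.inj p hp q hq hpq
    · exact absurd hpq ((hSE _ hq.2).2 p hp)
    · exact absurd hpq.symm ((hSE _ hp.2).2 q hq)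
    · exact Prod.ext (hp.1.trans hq.1.symm) hpq
  · rcases Nat.lt_succ_iff_lt_or_eq.1 hjc with hjc | rfl
    · rw [← h.two j hj hjc]
      congr 1
      ext p
      simp only [Finset.mem_filter, mem_addCol]
      constructor
      · rintro ⟨hp | hp, hpj⟩
        · exact ⟨hp, hpj⟩
        · omega
      · exact fun hp => ⟨Or.inl hp.1, hp.2⟩
    · rw [← hS.2, ← Finset.card_image_of_injective S (Prod.mk_right_injective j)]
      congr 1
      ext p
      simp only [Finset.mem_filter, mem_addCol, Finset.mem_image]
      constructor
      · rintro ⟨hp | hp, hpj⟩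
        · have := h.mem p hp; omega
        · exact ⟨p.2, hp.2, Prod.ext hpj.symm rfl⟩
      · rintro ⟨i, hi, rfl⟩
        exact ⟨Or.inr ⟨rfl, hi⟩, rfl⟩
  · by_cases hp : ∃ p ∈ U, p.2 = i
    · obtain ⟨p, hp, hpi⟩ := hp
      exact ⟨p, mem_addCol.2 (Or.inl hp), hpi⟩
    · have hic' : i = c := by
        by_contra hne
        exact hp (h.filled i hi (by omega))
      push Not at hp
      subst hic'
      exact ⟨(i, i), mem_addCol.2 (Or.inr ⟨rfl, hcS (mem_emptyRows.2 ⟨by omega, hp⟩)⟩), rfl⟩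

lemma IsPartial.mem_colRows_self {n c : ℕ} {T : Finset (ℕ × ℕ)} (h : IsPartial n (n + 1) T)
    (hc : 1 ≤ c) (hcn : c ≤ n) (hE : c ∈ emptyRows n (SymDellac.truncCols c T)) :
    c ∈ colRows T c := by
  obtain ⟨⟨a, b⟩, hp, rfl⟩ := h.exists_row hc (by omega : c ≤ 2 * n)
  have := h.mem _ hp
  simp only at this hcn hE ⊢
  rw [mem_colRows]
  by_cases hab : a < b
  · exact absurd rfl ((mem_emptyRows.1 hE).2 _ (mem_truncCols.2 ⟨hp, hab⟩))
  · obtain rfl : a = b := by omega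
    exact hp

open Polynomial in
lemma sum_prod_colWt (n k : ℕ) : ∀ c, 1 ≤ c → c + k = n → ∀ U, IsPartial n c U →
    ∑ T ∈ (TneF n).filter (fun T => truncCols c T = U),
      ∏ j ∈ Finset.Ico c n, colWt n j (rootVal (2 * n) j T) (colRows T j) =
    stateSum n k c (emptyRows n U) := by
  induction k with
  | zero =>
    intro c hc hk U hU
    obtain rfl : c = n := hk
    have hcard := (hU.isRootMap hc le_rfl).card
    have hE : emptyRows c U ∈ Finset.powersetCard 2 (emptyRows c U) :=
      Finset.mem_powersetCard.2 ⟨subset_rfl, by omega⟩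
    have : (TneF c).filter (fun T => truncCols c T = U) = {addCol c U (emptyRows c U)} := by
      ext T
      rw [Finset.mem_filter, Finset.mem_singleton, mem_TneF]
      constructor
      · rintro ⟨hT, rfl⟩
        rw [← hT.colRows_last hc, ← truncCols_succ]
        ext p
        rw [mem_truncCols]
        exact ⟨fun hp => ⟨hp, (hT.mem p hp).2.1⟩, fun hp => hp.1⟩
      · rintro rfl
        exact ⟨hU.addCol hc hE id le_rfl, hU.truncCols_addCol _⟩
    rw [this, Finset.sum_singleton, Finset.Ico_self, Finset.prod_empty, stateSum,
      stageSum]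
  | succ k ih =>
    intro c hc hk U hU
    rw [← stateSum_succ k (hU.isRootMap hc (by omega)) hc (by omega),
      ← Finset.sum_fiberwise_of_maps_to (g := fun T => colRows T c)
        (t := (Finset.powersetCard 2 (emptyRows n U)).filter
          fun S => c ∈ emptyRows n U → c ∈ S)]
    · refine Finset.sum_congr rfl fun S hS => ?_
      rw [Finset.mem_filter] at hS
      rw [← emptyRows_addCol n c, ← ih (c + 1) (by omega) (by omega) _
        (hU.addCol hc hS.1 hS.2 (by omega)), Finset.mul_sum]
      have hfil : ((TneF n).filter (fun T => truncCols c T = U)).filter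
          (fun T => colRows T c = S) =
          (TneF n).filter (fun T => truncCols (c + 1) T = addCol c U S) := by
        rw [Finset.filter_filter]
        refine Finset.filter_congr fun T _ => ⟨?_, fun hT => ⟨?_, ?_⟩⟩
        · rintro ⟨rfl, rfl⟩
          exact truncCols_succ c T
        · rw [← truncCols_truncCols (Nat.le_succ c), hT, hU.truncCols_addCol]
        · rw [← colRows_truncCols (Nat.lt_succ_self c), hT, hU.colRows_addCol]
      rw [hfil]
      refine Finset.sum_congr rfl fun T hT => ?_
      rw [← hfil, Finset.mem_filter, Finset.mem_filter, mem_TneF] at hT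
      obtain ⟨⟨hT, rfl⟩, rfl⟩ := hT
      rw [Finset.prod_eq_prod_Ico_succ_bot (by omega), hT.rootVal_truncCols]
    · intro T hT
      rw [Finset.mem_filter, mem_TneF] at hT
      obtain ⟨hT, rfl⟩ := hT
      exact Finset.mem_filter.2 ⟨hT.colRows_mem hc (by omega), hT.mem_colRows_self hc (by omega)⟩

lemma emptyRows_empty (n : ℕ) : emptyRows n ∅ = Finset.Icc 1 (2 * n) := by
  simp [emptyRows]

open Polynomial in
lemma stateSum_init {n : ℕ} (hn : 1 ≤ n) :
    stateSum n (n - 1) 1 (Finset.Icc 1 (2 * n)) = P n := by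
  obtain ⟨m, rfl⟩ : ∃ m, n = m + 1 := ⟨n - 1, by omega⟩
  have h1 : boundRows (m + 1) 1 (Finset.Icc 1 (2 * (m + 1))) =
      Finset.Icc 1 m ∪ Finset.Icc (2 * (m + 1) - m) (2 * (m + 1) - 1) := by
    ext i
    simp only [boundRows, Finset.mem_filter, Finset.mem_Icc, Finset.mem_union]
    omega
  have h2 : (Finset.Icc 1 m ∪ Finset.Icc (2 * (m + 1) - m) (2 * (m + 1) - 1)).card = 2 * m := by
    rw [Finset.card_union_of_disjoint, Nat.card_Icc, Nat.card_Icc]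
    · omega
    · rw [Finset.disjoint_left]
      intro i
      simp only [Finset.mem_Icc]
      omega
  rw [stateSum, h1, h2, Nat.add_sub_cancel, stageSum_eq_comp _ _ (by omega), Nat.card_Icc]
  have h3 : (X : ℚ[X]) + ((2 * (m + 1) + 1 - 1 : ℕ) : ℚ[X]) - 2 - ((2 * m : ℕ) : ℚ[X]) = X := by
    rw [Nat.add_sub_cancel]; push_cast; ring
  rw [h3, comp_X]

/-- **Theorem 1.9.** For all `n ≥ 1`,
`P_n(x) = Σ_{T ∈ T_n^e} 2^{fr(T) - 1 - max(T)} x^{max(T)}`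
(in particular `fr(T) - 1 - max(T) ≥ 0` for every `T ∈ T_n^e`). -/
theorem statement0 (n : ℕ) (hn : 1 ≤ n) :
    (∀ T ∈ TneF n, maxStat n T + 1 ≤ frE n T) ∧
    P n = ∑ T ∈ TneF n,
      Polynomial.C ((2 : ℚ) ^ (frE n T - 1 - maxStat n T)) * Polynomial.X ^ (maxStat n T) := by
  refine ⟨fun T hT => (mem_TneF.1 hT).maxStat_lt_frE hn, ?_⟩
  have hempty : IsPartial n 1 ∅ :=
    ⟨fun p hp => absurd hp (Finset.notMem_empty p), fun p hp => absurd hp (Finset.notMem_empty p),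
      fun j hj hj1 => absurd hj1 (by omega), fun i hi hi1 => absurd hi1 (by omega)⟩
  have hsum := sum_prod_colWt n (n - 1) 1 le_rfl (by omega) ∅ hempty
  rw [emptyRows_empty, stateSum_init hn, Finset.filter_true_of_mem] at hsum
  · rw [← hsum]
    exact Finset.sum_congr rfl fun T hT => ((mem_TneF.1 hT).weight_eq_prod hn).symm
  · intro T hT
    refine Finset.filter_eq_empty_iff.2 fun p hp => ?_
    have := (mem_TneF.1 hT).mem p hp
    omega

end SymDellac
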